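/- arXiv:2009.05278 — 2 statements merged into one kernel-verified Lean document; each statement's English description precedes it below -/
import Mathlib

section
/- 31 divides the class number of the compositum ℚ(2)·ℚ(31) = ℚ(√2)·ℚ(31), a totally real abelian field of degree 62 over ℚ; equivalently, the 31-class group of ℚ(2)·ℚ(31) is nontrivial. -/
open NumberField

theorem absNorm_modEq_one (n : ℕ) [NeZero n] (C : Type*) [Field C] [NumberField C]
    [IsCyclotomicExtension {n} ℚ C] (I : Ideal (𝓞 C)) (hI : (Ideal.absNorm I).Coprime n) :
    Ideal.absNorm I ≡ 1 [MOD n] := by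
  induction I using UniqueFactorizationMonoid.induction_on_prime with
  | h₁ =>
    have h : n = 1 := by simpa using hI
    subst h
    exact Nat.modEq_one
  | h₂ I hu => simp [Ideal.isUnit_iff.mp hu, Nat.ModEq.refl]
  | h₃ I P hI₀ hP ih =>
    rw [map_mul, Nat.coprime_mul_iff_left] at hI
    rw [map_mul]
    suffices Ideal.absNorm P ≡ 1 [MOD n] by simpa using this.mul (ih hI.2)
    have hP' : P.IsPrime := Ideal.isPrime_of_prime hP
    have : P.IsMaximal := hP'.isMaximal hP.ne_zero
    have hP₁ : Ideal.absNorm P ≠ 1 := Ideal.absNorm_eq_one_iff.not.mpr hP'.ne_top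
    have hζ := ((IsCyclotomicExtension.zeta_spec n ℚ C).toInteger_isPrimitiveRoot).idealQuotient_mk
      hP₁ hI.1
    let _ := Ideal.Quotient.field P
    have hdvd : n ∣ Ideal.absNorm P - 1 := by
      have h := orderOf_dvd_natCard (hζ.isUnit (NeZero.ne n)).unit
      rw [← (IsPrimitiveRoot.coe_units_iff.mp (show IsPrimitiveRoot
        (((hζ.isUnit (NeZero.ne n)).unit : (𝓞 C ⧸ P)ˣ) : 𝓞 C ⧸ P) n from hζ)).eq_orderOf,
        Nat.card_units] at h
      exact h
    have hpos : 1 ≤ Ideal.absNorm P :=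
      Nat.one_le_iff_ne_zero.mpr (Ideal.absNorm_eq_zero_iff.not.mpr hP.ne_zero)
    exact ((Nat.modEq_iff_dvd' hpos).mpr hdvd).symm

theorem norm_pow_finrank_eq_one (n : ℕ) [NeZero n] (F C : Type*) [Field F] [NumberField F]
    [Field C] [NumberField C] [Algebra F C] [IsCyclotomicExtension {n} ℚ C]
    (heven : Even (Module.finrank F C)) (x : 𝓞 F) (hx : IsCoprime (Algebra.norm ℤ x) n) :
    ((Algebra.norm ℤ x : ℤ) : ZMod n) ^ Module.finrank F C = 1 := by
  have hnorm : Algebra.norm ℤ (algebraMap (𝓞 F) (𝓞 C) x) =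
      Algebra.norm ℤ x ^ Module.finrank F C := by
    have h : Algebra.norm ℚ (algebraMap F C x) = Algebra.norm ℚ (x : F) ^ Module.finrank F C := by
      rw [← Algebra.norm_norm (S := F), Algebra.norm_algebraMap, map_pow]
    have h' := Algebra.coe_norm_int (algebraMap (𝓞 F) (𝓞 C) x)
    apply Int.cast_injective (α := ℚ)
    rw [h', Int.cast_pow, Algebra.coe_norm_int, ← h]
    rfl
  have habs := Ideal.absNorm_span_singleton (algebraMap (𝓞 F) (𝓞 C) x)
  rw [hnorm] at habs
  have hmod := absNorm_modEq_one n C (Ideal.span {algebraMap (𝓞 F) (𝓞 C) x}) (by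
    rw [habs, Int.natAbs_pow]
    exact Nat.Coprime.pow_left _ (Int.isCoprime_iff_gcd_eq_one.mp hx))
  rw [habs, ← ZMod.natCast_eq_natCast_iff, ← Int.cast_natCast,
    Int.natAbs_of_nonneg (heven.pow_nonneg _)] at hmod
  simpa using hmod

/-- Descent by the unit `1 + √2`: here `116` is a square root of `2` modulo `31 ^ 2`, and the
thirtieth powers of `1 ± 116` are `1`. -/
theorem pow_thirty_of_sq_sub_two_mul_sq (n : ℕ) (c d : ℤ) (hd : d.natAbs = n)
    (h : |c ^ 2 - 2 * d ^ 2| = 31) :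
    (c + 116 * d : ZMod (31 ^ 2)) ^ 30 = 0 ∨ (c + 116 * d : ZMod (31 ^ 2)) ^ 30 = 900 := by
  induction n using Nat.strong_induction_on generalizing c d with
  | _ n ih =>
    subst hd
    have h' := (abs_eq (by norm_num)).mp h
    by_cases hsmall : d.natAbs ≤ 3
    · obtain ⟨hd1, hd2⟩ : -3 ≤ d ∧ d ≤ 3 := by omega
      obtain ⟨hc1, hc2⟩ := abs_le_of_sq_le_sq'
        (show c ^ 2 ≤ 7 ^ 2 by rcases h' with h | h <;> nlinarith) (by norm_num)
      clear ih hsmall h'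
      interval_cases d <;> interval_cases c <;> first | (exfalso; revert h; decide) | decide
    · have hr : (116 : ZMod (31 ^ 2)) ^ 2 = 2 := by decide
      have hd4 : 4 ^ 2 ≤ d ^ 2 := by
        exact Int.natAbs_le_iff_sq_le.mp (by omega)
      have hlt : c.natAbs < (2 * d).natAbs :=
        Int.natAbs_lt_iff_sq_lt.mpr (by rcases h' with h | h <;> nlinarith)
      have hne : c ≠ 0 := by
        rintro rfl
        rcases h' with h | h <;> omega
      rcases lt_or_gt_of_ne (mul_ne_zero hne (show d ≠ 0 by omega)) with hcd | hcd
      · have key := ih (c + d).natAbs (by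
          rcases mul_neg_iff.mp hcd with h | h <;> omega) (c + 2 * d) (c + d) rfl (by
          rw [← h, ← abs_neg]; ring_nf)
        have : (c + 116 * d : ZMod (31 ^ 2)) =
            (((c + 2 * d : ℤ) : ZMod (31 ^ 2)) + 116 * ((c + d : ℤ) : ZMod (31 ^ 2))) * (116 - 1) := by
          push_cast
          linear_combination (-(c : ZMod (31 ^ 2)) - d) * hr
        rwa [this, mul_pow, show (116 - 1 : ZMod (31 ^ 2)) ^ 30 = 1 by decide, mul_one]
      · have key := ih (c - d).natAbs (by
          rcases mul_pos_iff.mp hcd with h | h <;> omega) (2 * d - c) (c - d) rfl (by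
          rw [← h, ← abs_neg]; ring_nf)
        have : (c + 116 * d : ZMod (31 ^ 2)) =
            (((2 * d - c : ℤ) : ZMod (31 ^ 2)) + 116 * ((c - d : ℤ) : ZMod (31 ^ 2))) * (116 + 1) := by
          push_cast
          linear_combination (-(c : ZMod (31 ^ 2)) + d) * hr
        rwa [this, mul_pow, show (116 + 1 : ZMod (31 ^ 2)) ^ 30 = 1 by decide, mul_one]

theorem two_pow_dvd_of_sq_sub_two_mul_sq (k : ℕ) (c d m : ℤ) (h : c ^ 2 - 2 * d ^ 2 = 4 ^ k * m) :
    ∃ c' d' : ℤ, c = 2 ^ k * c' ∧ d = 2 ^ k * d' ∧ c' ^ 2 - 2 * d' ^ 2 = m := by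
  induction k generalizing c d with
  | zero => exact ⟨c, d, by simp, by simp, by simpa using h⟩
  | succ k ih =>
    rw [pow_succ' 4] at h
    obtain ⟨c₁, rfl⟩ : Even c := by
      have : Even (c ^ 2) := ⟨d ^ 2 + 2 * (4 ^ k * m), by linarith⟩
      exact (Int.even_pow.mp this).1
    obtain ⟨d₁, rfl⟩ : Even d := by
      have : Even (d ^ 2) := ⟨c₁ ^ 2 - 4 ^ k * m, by linarith⟩
      exact (Int.even_pow.mp this).1
    obtain ⟨c', d', rfl, rfl, h'⟩ := ih c₁ d₁ (by linarith)
    exact ⟨c', d', by ring, by ring, h'⟩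

theorem exists_norm_sq_sub_two_mul_sq {S : Type*} [CommRing S] [Module.Free ℤ S] [Module.Finite ℤ S]
    (a b : S) : ∃ c d : ℤ, Algebra.norm ℤ (a ^ 2 - 2 * b ^ 2) = c ^ 2 - 2 * d ^ 2 ∧
      ∀ (n : ℕ) (r : ℤ), (r : ZMod n) * r = 2 →
        ((Algebra.norm ℤ (a + r * b) : ℤ) : ZMod n) = c + r * d := by
  classical
  let B := Module.Free.chooseBasis ℤ S
  let M := Algebra.leftMulMatrix B
  let ι := (Int.castRingHom (ℤ√2)).mapMatrix (m := Module.Free.ChooseBasisIndex ℤ S)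
  let D : ℤ√2 := (ι (M a) + (Zsqrtd.sqrtd : ℤ√2) • ι (M b)).det
  have hι (R : Type _) [CommRing R] (f : ℤ√2 →+* R) (A : Matrix _ _ ℤ) :
      f.mapMatrix (ι A) = (Int.castRingHom R).mapMatrix A := by
    ext i j
    simp [ι]
  have hD (R : Type _) [CommRing R] (f : ℤ√2 →+* R) :
      f D = ((Int.castRingHom R).mapMatrix (M a) +
        f Zsqrtd.sqrtd • (Int.castRingHom R).mapMatrix (M b)).det := by
    rw [RingHom.map_det, map_add, hι, ← hι R f (M b)]
    congr 2
    ext i j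
    simp
  have hN (R : Type _) [CommRing R] (x : S) :
      ((Algebra.norm ℤ x : ℤ) : R) = ((Int.castRingHom R).mapMatrix (M x)).det := by
    rw [Algebra.norm_eq_matrix_det B, ← RingHom.map_det, eq_intCast]
  refine ⟨D.re, D.im, ?_, fun n r hr => ?_⟩
  · have hstar := hD (ℤ√2) (starRingEnd (ℤ√2))
    have h : ((D.norm : ℤ) : ℤ√2) = ((Algebra.norm ℤ (a ^ 2 - 2 * b ^ 2) : ℤ) : ℤ√2) := by
      rw [Zsqrtd.norm_eq_mul_conj, ← starRingEnd_apply, hstar, ← Matrix.det_mul, hN]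
      congr 1
      have hs : starRingEnd (ℤ√2) Zsqrtd.sqrtd = -Zsqrtd.sqrtd := by
        ext <;> simp [starRingEnd_apply]
      have hcomm : ι (M b) * ι (M a) = ι (M a) * ι (M b) := by
        rw [← map_mul, ← map_mul, ← map_mul, ← map_mul, mul_comm]
      have h2 : (Zsqrtd.sqrtd : ℤ√2) * Zsqrtd.sqrtd = 2 := by ext <;> simp
      have hM : (Int.castRingHom (ℤ√2)).mapMatrix (M (a ^ 2 - 2 * b ^ 2)) =
          ι (M a) ^ 2 - 2 * ι (M b) ^ 2 := by
        simp only [ι, M, map_sub, map_mul, map_pow, map_ofNat]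
      rw [hM, hs]
      change (ι (M a) + Zsqrtd.sqrtd • ι (M b)) * (ι (M a) + -Zsqrtd.sqrtd • ι (M b)) = _
      simp only [add_mul, mul_add, neg_smul, mul_neg, Matrix.smul_mul, Matrix.mul_smul, smul_smul,
        hcomm, h2, ofNat_smul_eq_nsmul, nsmul_eq_mul, pow_two]
      push_cast
      abel
    rw [← Int.cast_injective h, Zsqrtd.norm_def]
    ring
  · have h := hD (ZMod n) (Zsqrtd.lift ⟨(r : ZMod n), by simpa using hr⟩)
    rw [Zsqrtd.lift_apply_apply, Zsqrtd.lift_apply_apply] at h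
    rw [hN, mul_comm (r : ZMod n), h]
    congr 1
    rw [map_add, map_add, map_mul, map_mul, map_intCast, map_intCast, Algebra.smul_def]
    simp

theorem norm_trace_add_mul_of_sq_eq_two {F K : Type*} [Field F] [Field K] [Algebra F K]
    (s : K) (hs : s ^ 2 = 2) (hsF : ∀ x : F, x ^ 2 ≠ 2)
    (hgen : ∀ z : K, ∃ x y : F, z = algebraMap F K x + algebraMap F K y * s) :
    Module.finrank F K = 2 ∧ ∀ x y : F,
      Algebra.norm F (algebraMap F K x + algebraMap F K y * s) = x ^ 2 - 2 * y ^ 2 ∧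
      Algebra.trace F K (algebraMap F K x + algebraMap F K y * s) = 2 * x := by
  have hsr (x : F) : algebraMap F K x ≠ s := fun h => hsF x ((algebraMap F K).injective (by
    rw [map_pow, h, hs, map_ofNat]))
  have hli : LinearIndependent F ![1, s] := by
    rw [LinearIndependent.pair_iff' one_ne_zero]
    intro x hx
    exact hsr x (by rw [← hx, Algebra.smul_def, mul_one])
  have hsp : ⊤ ≤ Submodule.span F (Set.range ![1, s]) := by
    intro z _
    obtain ⟨x, y, rfl⟩ := hgen z
    rw [Matrix.range_cons, Matrix.range_cons, Matrix.range_empty, Set.union_empty,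
      Set.singleton_union, Submodule.mem_span_pair]
    exact ⟨x, y, by simp [Algebra.smul_def]⟩
  let b := Module.Basis.mk hli hsp
  have hb0 : b 0 = 1 := by simp [b]
  have hb1 : b 1 = s := by simp [b]
  have hrepr (x y : F) : b.repr (algebraMap F K x + algebraMap F K y * s) =
      Finsupp.single 0 x + Finsupp.single 1 y := by
    rw [← mul_one (algebraMap F K x), ← hb0, ← hb1, ← Algebra.smul_def, ← Algebra.smul_def]
    simp
  refine ⟨by rw [Module.finrank_eq_card_basis b, Fintype.card_fin], fun x y => ?_⟩
  have hmat : Algebra.leftMulMatrix b (algebraMap F K x + algebraMap F K y * s) =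
      !![x, 2 * y; y, x] := by
    have h1 : (algebraMap F K x + algebraMap F K y * s) * s =
        algebraMap F K (2 * y) + algebraMap F K x * s := by
      rw [map_mul, map_ofNat]
      linear_combination algebraMap F K y * hs
    ext i j
    rw [Algebra.leftMulMatrix_eq_repr_mul]
    fin_cases i <;> fin_cases j <;>
      simp only [Fin.zero_eta, Fin.mk_one, hb0, hb1, mul_one, h1, hrepr] <;> simp
  rw [Algebra.norm_eq_matrix_det b, Algebra.trace_eq_matrix_trace b, hmat, Matrix.det_fin_two_of,
    Matrix.trace_fin_two_of]
  exact ⟨by ring, by ring⟩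

theorem sq_ne_two_of_odd_finrank {F : Type*} [Field F] [NumberField F]
    (hF : Odd (Module.finrank ℚ F)) (x : F) : x ^ 2 ≠ 2 := by
  intro hx
  obtain ⟨k, hk⟩ := hF
  have h : Algebra.norm ℚ x ^ 2 = 2 ^ (2 * k + 1) := by
    rw [← map_pow, hx, ← hk, ← map_ofNat (algebraMap ℚ F) 2, Algebra.norm_algebraMap]
  have h2 : IsSquare (2 : ℚ) := ⟨Algebra.norm ℚ x / 2 ^ k, by
    field_simp
    linear_combination -h⟩
  rw [Rat.isSquare_ofNat_iff] at h2
  exact Nat.prime_two.prime.not_isSquare h2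

theorem associated_prime_pow_finrank (p k : ℕ) [Fact p.Prime] (F C : Type*) [Field F] [NumberField F]
    [Field C] [NumberField C] [Algebra F C] [IsCyclotomicExtension {p ^ (k + 1)} ℚ C] :
    ∃ ϖ : 𝓞 F, Associated (p : 𝓞 F) (ϖ ^ Module.finrank ℚ F) := by
  have hζ := IsCyclotomicExtension.zeta_spec (p ^ (k + 1)) ℚ C
  have h := IsCyclotomicExtension.Rat.map_eq_span_zeta_sub_one_pow p k hζ
  rw [Ideal.map_span, Set.image_singleton, Ideal.span_singleton_pow,
    Ideal.span_singleton_eq_span_singleton, ← Module.finrank_mul_finrank ℚ F C, pow_mul] at h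
  refine ⟨RingOfIntegers.norm F (hζ.toInteger - 1), ?_⟩
  have h := h.map (RingOfIntegers.norm F)
  rw [algebraMap_int_eq, map_natCast, ← map_natCast (algebraMap (𝓞 F) (𝓞 C)),
    RingOfIntegers.norm_algebraMap, map_pow, map_pow] at h
  have hpos : Module.finrank F C ≠ 0 := Module.finrank_pos.ne'
  exact associated_of_dvd_dvd ((IsIntegrallyClosed.pow_dvd_pow_iff hpos).mp h.dvd)
    ((IsIntegrallyClosed.pow_dvd_pow_iff hpos).mp h.symm.dvd)

theorem exists_pow_eq_span {F K : Type*} (C : Type*) [Field F] [NumberField F] [Field K]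
    [NumberField K] [Field C] [NumberField C] [Algebra F K] [Algebra F C]
    [IsCyclotomicExtension {31 ^ 2} ℚ C] (hF : Module.finrank ℚ F = 31) (s : 𝓞 K) (hs : s ^ 2 = 2) :
    ∃ P : Ideal (𝓞 K), P ^ 31 = Ideal.span {1 + 4 * s} := by
  have : Fact (Nat.Prime 31) := ⟨by norm_num⟩
  have : IsCyclotomicExtension {31 ^ (1 + 1)} ℚ C := ‹_›
  obtain ⟨ϖ, hϖ⟩ := associated_prime_pow_finrank 31 1 F C
  rw [hF] at hϖ
  have hϖ := hϖ.map (algebraMap (𝓞 F) (𝓞 K))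
  rw [map_natCast, map_pow] at hϖ
  have hmul : Ideal.span {1 + 4 * s} * Ideal.span {1 - 4 * s} =
      Ideal.span {algebraMap (𝓞 F) (𝓞 K) ϖ} ^ 31 := by
    rw [Ideal.span_singleton_mul_span_singleton, Ideal.span_singleton_pow,
      Ideal.span_singleton_eq_span_singleton]
    refine Associated.trans ?_ hϖ
    rw [← Associated.neg_left_iff]
    refine .of_eq ?_
    push_cast
    linear_combination 16 * hs
  have hcop : IsCoprime (Ideal.span {1 + 4 * s}) (Ideal.span {1 - 4 * s}) := by
    rw [Ideal.isCoprime_span_singleton_iff]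
    refine ⟨16 + (1 - 4 * s), 16, ?_⟩
    linear_combination -16 * hs
  obtain ⟨P, hP⟩ := exists_eq_pow_of_mul_eq_pow_of_coprime hcop hmul
  exact ⟨P, hP.symm⟩

theorem thirtyone_dvd_card_classGroup_of_quadratic {F K : Type*} (C : Type*) [Field F]
    [NumberField F] [Field K] [NumberField K] [Field C] [NumberField C] [Algebra F K] [Algebra F C]
    [IsCyclotomicExtension {31 ^ 2} ℚ C] (hF : Module.finrank ℚ F = 31) (s : K)
    (hs : s ^ 2 = 2) (hgen : ∀ z : K, ∃ x y : F, z = algebraMap F K x + algebraMap F K y * s) :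
    31 ∣ Nat.card (ClassGroup (𝓞 K)) := by
  by_contra hcl
  obtain ⟨hFK, hnt⟩ := norm_trace_add_mul_of_sq_eq_two s hs
    (sq_ne_two_of_odd_finrank (by rw [hF]; decide)) hgen
  have hKdeg : Module.finrank ℚ K = 62 := by rw [← Module.finrank_mul_finrank ℚ F K, hF, hFK]
  have hFCdeg : Module.finrank F C = 30 := by
    have h := Module.finrank_mul_finrank ℚ F C
    rw [IsCyclotomicExtension.Rat.finrank (31 ^ 2) C, hF,
      Nat.totient_prime_pow (by norm_num) (by norm_num)] at h
    omega
  have hsint : IsIntegral ℤ s := .of_pow two_pos (by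
    rw [hs, ← one_add_one_eq_two]
    exact isIntegral_one.add isIntegral_one)
  obtain ⟨S, hS⟩ : ∃ S : 𝓞 K, (S : K) = s := ⟨⟨s, hsint⟩, rfl⟩
  obtain ⟨P, hP⟩ := exists_pow_eq_span C hF S (by ext; simpa [hS, map_ofNat] using hs)
  obtain ⟨α, hα⟩ : ∃ α, P = Ideal.span {α} := by
    have h : (P ^ 31).IsPrincipal := ⟨_, hP⟩
    refine (Ideal.IsPrincipal.of_isPrincipal_pow_of_coprime ?_ h).principal
    rw [← Nat.card_eq_fintype_card]
    exact (Nat.Prime.coprime_iff_not_dvd (by norm_num)).mpr hcl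
  have hNα : |Algebra.norm ℤ α| = 31 := by
    have h : Algebra.norm ℤ (1 + 4 * S) = (-31) ^ 31 := by
      apply Int.cast_injective (α := ℚ)
      have h1 : ((1 + 4 * S : 𝓞 K) : K) =
          algebraMap F K 1 + algebraMap F K 4 * s := by
        simp [hS, map_ofNat]
      rw [Algebra.coe_norm_int, h1, ← Algebra.norm_norm (S := F), (hnt 1 4).1,
        show (1 ^ 2 - 2 * 4 ^ 2 : F) = algebraMap ℚ F (-31) by simp; norm_num,
        Algebra.norm_algebraMap, hF]
      norm_num
    have h2 := congrArg Ideal.absNorm hP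
    rw [hα, map_pow, Ideal.absNorm_span_singleton, Ideal.absNorm_span_singleton, h,
      Int.natAbs_pow] at h2
    have h3 := Nat.pow_left_injective (by norm_num : 31 ≠ 0) h2
    rw [Int.abs_eq_natAbs, h3]
    rfl
  obtain ⟨x, y, hxy⟩ := hgen α
  have hx : IsIntegral ℤ (4 * x) := by
    have h : IsIntegral ℤ (Algebra.trace F K (α : K)) :=
      Algebra.isIntegral_trace (RingOfIntegers.isIntegral_coe α)
    rw [hxy, (hnt x y).2] at h
    rw [show 4 * x = 2 * (2 * x) by ring]
    rw [← one_add_one_eq_two]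
    exact (isIntegral_one.add isIntegral_one).mul (by rwa [one_add_one_eq_two])
  have hy : IsIntegral ℤ (4 * y) := by
    have h := (Algebra.isIntegral_trace (L := F) ((RingOfIntegers.isIntegral_coe α).mul hsint))
    have h1 : (α : K) * s = algebraMap F K (2 * y) + algebraMap F K x * s := by
      rw [hxy, map_mul, map_ofNat]
      linear_combination algebraMap F K y * hs
    rw [h1, (hnt _ _).2] at h
    rwa [show 4 * y = 2 * (2 * y) by ring]
  obtain ⟨a, ha⟩ : ∃ a : 𝓞 F, (a : F) = 4 * x := ⟨⟨_, hx⟩, rfl⟩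
  obtain ⟨b, hb⟩ : ∃ b : 𝓞 F, (b : F) = 4 * y := ⟨⟨_, hy⟩, rfl⟩
  have hNab : Algebra.norm ℤ (a ^ 2 - 2 * b ^ 2) = 4 ^ 62 * Algebra.norm ℤ α := by
    apply Int.cast_injective (α := ℚ)
    have h1 : ((a ^ 2 - 2 * b ^ 2 : 𝓞 F) : F) = (4 * x) ^ 2 - 2 * (4 * y) ^ 2 := by
      simp [ha, hb, map_ofNat]
    have h2 : algebraMap F K (4 * x) + algebraMap F K (4 * y) * s = algebraMap ℚ K 4 * α := by
      rw [hxy]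
      simp only [map_mul, map_ofNat]
      ring
    rw [Int.cast_mul, Algebra.coe_norm_int, Algebra.coe_norm_int, h1, ← (hnt _ _).1,
      Algebra.norm_norm, h2, map_mul, Algebra.norm_algebraMap, hKdeg]
    norm_num
  obtain ⟨c, d, hcd, hmod⟩ := exists_norm_sq_sub_two_mul_sq a b
  rw [hNab] at hcd
  obtain ⟨c, d, rfl, rfl, hcd'⟩ := two_pow_dvd_of_sq_sub_two_mul_sq 62 c d _ hcd.symm
  have key (e : ℤ) (he : e * e = 1) : (31 : ℤ) ∣ Algebra.norm ℤ (a + (116 * e : ℤ) * b) := by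
    by_contra hdvd
    have hcop : IsCoprime (Algebra.norm ℤ (a + (116 * e : ℤ) * b)) ((31 ^ 2 : ℕ) : ℤ) := by
      rw [Nat.cast_pow]
      exact ((Prime.coprime_iff_not_dvd (Nat.prime_iff_prime_int.mp (by norm_num))).mpr
        hdvd).symm.pow_right
    have h1 := norm_pow_finrank_eq_one (31 ^ 2) F C (by rw [hFCdeg]; decide) _ hcop
    rw [hFCdeg, hmod _ _ (by
      have : ((e : ZMod (31 ^ 2)) * e) = 1 := by exact_mod_cast congrArg (Int.cast) he
      push_cast
      rw [mul_mul_mul_comm, this]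
      decide)] at h1
    have h2 : (2 ^ 62) ^ 30 * (c + 116 * (e * d : ℤ) : ZMod (31 ^ 2)) ^ 30 = 1 := by
      rw [← mul_pow, ← h1]
      push_cast
      ring
    rw [show ((2 ^ 62) ^ 30 : ZMod (31 ^ 2)) = 1 by rw [← pow_mul]; reduce_mod_char, one_mul] at h2
    rcases pow_thirty_of_sq_sub_two_mul_sq _ c (e * d) rfl (by
      rw [← hNα, ← hcd']
      congr 1
      linear_combination -2 * d ^ 2 * he) with h | h <;> rw [h] at h2 <;> revert h2 <;> decide
  obtain ⟨u, hu⟩ := key 1 rfl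
  obtain ⟨v, hv⟩ := key (-1) rfl
  have h1 := hmod (31 ^ 2) (116 * 1) (by decide)
  have h2 := hmod (31 ^ 2) (116 * -1) (by decide)
  rw [hu] at h1
  rw [hv] at h2
  have h3 : (2 ^ 124 : ZMod (31 ^ 2)) * ((c ^ 2 - 2 * d ^ 2 : ℤ) : ZMod (31 ^ 2)) = 0 := by
    have h961 : (31 : ZMod (31 ^ 2)) * 31 = 0 := by decide
    have hr : (116 : ZMod (31 ^ 2)) * 116 = 2 := by decide
    push_cast at h1 h2 ⊢
    linear_combination (u * v : ZMod (31 ^ 2)) * h961 - (2 ^ 62 * c + -116 * (2 ^ 62 * d)) * h1 -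
      31 * u * h2 + 2 ^ 124 * d ^ 2 * hr
  rw [hcd'] at h3
  rw [show (2 ^ 124 : ZMod (31 ^ 2)) = 388 by reduce_mod_char] at h3
  rcases (abs_eq (by norm_num)).mp hNα with h | h <;> rw [h] at h3 <;> revert h3 <;> decide

theorem isCyclotomicExtension_adjoin_of_isPrimitiveRoot (k : Type*) {L : Type*} [Field k] [Field L]
    [Algebra k L] {n : ℕ} [NeZero n] {ζ : L} (hζ : IsPrimitiveRoot ζ n) :
    IsCyclotomicExtension {n} k (IntermediateField.adjoin k {ζ}) := by
  change IsCyclotomicExtension {n} k (IntermediateField.adjoin k {ζ}).toSubalgebra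
  rw [IntermediateField.adjoin_simple_toSubalgebra_of_isAlgebraic
    (hζ.isIntegral (NeZero.pos n)).tower_top.isAlgebraic]
  exact hζ.adjoin_isCyclotomicExtension k

theorem ofReal_sqrt_two_sq : ((Real.sqrt 2 : ℝ) : ℂ) ^ 2 = 2 := by
  rw [← Complex.ofReal_pow, Real.sq_sqrt (by norm_num)]
  norm_num

theorem exists_eq_add_mul_sqrt_two (E : IntermediateField ℚ ℂ) (w : ℂ)
    (hw : w ∈ IntermediateField.adjoin ℚ {((Real.sqrt 2 : ℝ) : ℂ)} ⊔ E) :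
    ∃ x y : E, w = x + y * ((Real.sqrt 2 : ℝ) : ℂ) := by
  have hs := ofReal_sqrt_two_sq
  have hsint : IsIntegral E ((Real.sqrt 2 : ℝ) : ℂ) := .of_pow two_pos (by
    rw [hs, ← one_add_one_eq_two]
    exact isIntegral_one.add isIntegral_one)
  rw [sup_comm, ← IntermediateField.restrictScalars_adjoin_eq_sup ℚ E,
    IntermediateField.mem_restrictScalars, ← IntermediateField.mem_toSubalgebra,
    IntermediateField.adjoin_simple_toSubalgebra_of_isAlgebraic hsint.isAlgebraic] at hw
  induction hw using Algebra.adjoin_induction with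
  | mem w hw => exact ⟨0, 1, by simpa using hw⟩
  | algebraMap r => exact ⟨r, 0, by simp⟩
  | add u v _ _ hu hv =>
    obtain ⟨x, y, rfl⟩ := hu
    obtain ⟨x', y', rfl⟩ := hv
    exact ⟨x + x', y + y', by push_cast; ring⟩
  | mul u v _ _ hu hv =>
    obtain ⟨x, y, rfl⟩ := hu
    obtain ⟨x', y', rfl⟩ := hv
    refine ⟨x * x' + (1 + 1) * y * y', x * y' + y * x', ?_⟩
    push_cast
    linear_combination (y * y' : ℂ) * hs

/-- `31` divides the class number of the compositum `ℚ(√2)·ℚ(31)`, where `ℚ(31)` is the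
unique degree-`31` subfield of `ℚ(ζ_{31²})` (the first layer of the cyclotomic
`ℤ_31`-extension of `ℚ`), the compositum being taken inside `ℂ`. -/
theorem thirtyone_dvd_classNumber
    (K₁ K₂ : IntermediateField ℚ ℂ)
    (hK₁ : K₁ = IntermediateField.adjoin ℚ {((Real.sqrt 2 : ℝ) : ℂ)})
    (ζ : ℂ) (hζ : IsPrimitiveRoot ζ (31 ^ 2))
    (hK₂sub : K₂ ≤ IntermediateField.adjoin ℚ {ζ})
    (hK₂deg : Module.finrank ℚ K₂ = 31) :
    31 ∣ Nat.card (ClassGroup (𝓞 ↥(K₁ ⊔ K₂))) := by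
  have : NeZero ((31 : ℕ) ^ 2) := ⟨by norm_num⟩
  have hC : IsCyclotomicExtension {31 ^ 2} ℚ (IntermediateField.adjoin ℚ {ζ}) := by
    rw [Subsingleton.elim (DivisionRing.toRatAlgebra : Algebra ℚ (IntermediateField.adjoin ℚ {ζ}))
      (IntermediateField.algebra' _)]
    exact isCyclotomicExtension_adjoin_of_isPrimitiveRoot ℚ hζ
  have : NumberField (IntermediateField.adjoin ℚ {ζ}) :=
    IsCyclotomicExtension.numberField {31 ^ 2} ℚ _
  have : FiniteDimensional ℚ K₂ := .of_finrank_pos (by omega)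
  have : NumberField K₂ := ⟨⟩
  have hs := ofReal_sqrt_two_sq
  have hsint : IsIntegral ℚ ((Real.sqrt 2 : ℝ) : ℂ) := .of_pow two_pos (by
    rw [hs, ← one_add_one_eq_two]
    exact isIntegral_one.add isIntegral_one)
  have : FiniteDimensional ℚ K₁ := by
    rw [hK₁]
    exact IntermediateField.adjoin.finiteDimensional hsint
  have : NumberField ↥(K₁ ⊔ K₂) := ⟨⟩
  let _ : Algebra K₂ ↥(K₁ ⊔ K₂) := (IntermediateField.inclusion le_sup_right).toAlgebra
  let _ : Algebra K₂ (IntermediateField.adjoin ℚ {ζ}) :=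
    (IntermediateField.inclusion hK₂sub).toAlgebra
  have hsmem : ((Real.sqrt 2 : ℝ) : ℂ) ∈ K₁ ⊔ K₂ := by
    refine (le_sup_left : K₁ ≤ K₁ ⊔ K₂) ?_
    rw [hK₁]
    exact IntermediateField.mem_adjoin_simple_self ℚ _
  refine thirtyone_dvd_card_classGroup_of_quadratic (F := K₂)
    (K := ↥(K₁ ⊔ K₂)) (IntermediateField.adjoin ℚ {ζ})
    hK₂deg ⟨_, hsmem⟩ (Subtype.ext hs) fun z => ?_
  obtain ⟨x, y, h⟩ := exists_eq_add_mul_sqrt_two K₂ z (by rw [← hK₁]; exact z.2)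
  exact ⟨x, y, Subtype.ext h⟩
end

section
/- 18433 divides the class number of the compositum ℚ(2^8)·ℚ(18433), where ℚ(2^8) is the maximal real subfield of ℚ(ζ_{2^{10}}) (the 8-th layer of the cyclotomic ℤ_2-extension of ℚ); equivalently, the 18433-class group of ℚ(2^8)·ℚ(18433) is nontrivial. -/
open NumberField Polynomial

theorem monoidHom_eq_one_of_le_finrank_span {E G V : Type*} [CommGroup E] [CommGroup G] {p : ℕ}
    [Fact p.Prime] [AddCommGroup V] [Module (ZMod p) V] [Module.Finite (ZMod p) V] {s w : ℕ}
    (hw : w.Coprime p) (η : Fin s → E)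
    (hη : ∀ x : E, ∃ (t : E) (n : Fin s → ℤ), t ^ w = 1 ∧ x = t * ∏ i, η i ^ n i)
    (L : E →* Multiplicative V) {ι : Type*} (ε : ι → E)
    (hε : s ≤ Module.finrank (ZMod p)
      (Submodule.span (ZMod p) (Set.range fun i => (L (ε i)).toAdd)))
    (Φ : E →* G) (hΦ : ∀ x, Φ x ^ p = 1) (hΦε : ∀ i, Φ (ε i) = 1) (x : E) : Φ x = 1 := by
  have htors : ∀ t : E, t ^ w = 1 → ∃ t', t = t' ^ p := by
    intro t ht
    refine ⟨t ^ (w.gcdB p), ?_⟩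
    have h1 : (1 : ℤ) = w * w.gcdA p + p * w.gcdB p := by
      rw [← Nat.gcd_eq_gcd_ab, hw]
      rfl
    rw [← zpow_natCast (t ^ _), ← zpow_mul, mul_comm]
    conv_lhs => rw [← zpow_one t, h1, zpow_add, zpow_mul, zpow_natCast, ht, one_zpow, one_mul]
  have hLp : ∀ y : E, (L (y ^ p)).toAdd = 0 := by
    intro y
    rw [map_pow, toAdd_pow, ← Nat.cast_smul_eq_nsmul (ZMod p), CharP.cast_eq_zero, zero_smul]
  have hL : ∀ (t : E) (n : Fin s → ℤ), t ^ w = 1 →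
      (L (t * ∏ i, η i ^ n i)).toAdd = ∑ i, (n i : ZMod p) • (L (η i)).toAdd := by
    intro t n ht
    obtain ⟨t', rfl⟩ := htors t ht
    rw [map_mul, toAdd_mul, hLp, zero_add, map_prod, toAdd_prod]
    refine Finset.sum_congr rfl fun i _ => ?_
    rw [map_zpow, toAdd_zpow, Int.cast_smul_eq_zsmul]
  set U := Submodule.span (ZMod p) (Set.range fun i => (L (ε i)).toAdd) with hU
  set W := Submodule.span (ZMod p) (Set.range fun i => (L (η i)).toAdd) with hW
  have hmem : ∀ y, (L y).toAdd ∈ W := by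
    intro y
    obtain ⟨t, n, ht, rfl⟩ := hη y
    rw [hL t n ht]
    exact Submodule.sum_mem _ fun i _ => Submodule.smul_mem _ _ (Submodule.subset_span ⟨i, rfl⟩)
  have hUW : U ≤ W := Submodule.span_le.mpr (by rintro _ ⟨i, rfl⟩; exact hmem _)
  have hWs : Module.finrank (ZMod p) W ≤ s :=
    (finrank_range_le_card (R := ZMod p) fun i => (L (η i)).toAdd).trans_eq (Fintype.card_fin s)
  have hUW' : U = W := Submodule.eq_of_le_of_finrank_le hUW (hWs.trans hε)
  have hind : LinearIndependent (ZMod p) fun i => (L (η i)).toAdd := by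
    rw [linearIndependent_iff_card_le_finrank_span, Fintype.card_fin]
    exact hε.trans (Submodule.finrank_mono hUW)
  have hx : (L x).toAdd ∈ U := hUW' ▸ hmem x
  have key : ∀ v ∈ U, ∃ y : E, Φ y = 1 ∧ (L y).toAdd = v := by
    intro v hv
    induction hv using Submodule.span_induction with
    | mem v hv =>
      obtain ⟨i, rfl⟩ := hv
      exact ⟨ε i, hΦε i, rfl⟩
    | zero => exact ⟨1, map_one _, by simp⟩
    | add v v' _ _ h h' =>
      obtain ⟨y, hy, rfl⟩ := h
      obtain ⟨y', hy', rfl⟩ := h'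
      exact ⟨y * y', by rw [map_mul, hy, hy', one_mul], by simp⟩
    | smul a v _ h =>
      obtain ⟨y, hy, rfl⟩ := h
      refine ⟨y ^ a.val, by rw [map_pow, hy, one_pow], ?_⟩
      rw [map_pow, toAdd_pow, ← Nat.cast_smul_eq_nsmul (ZMod p), ZMod.natCast_zmod_val]
  obtain ⟨y, hy, hyx⟩ := key _ hx
  obtain ⟨t, n, ht, hxy⟩ := hη (x * y⁻¹)
  have h0 : ∑ i, (n i : ZMod p) • (L (η i)).toAdd = 0 := by
    rw [← hL t n ht, ← hxy, map_mul, toAdd_mul, map_inv, toAdd_inv, hyx, add_neg_cancel]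
  have hn : ∀ i, (p : ℤ) ∣ n i := fun i =>
    (ZMod.intCast_zmod_eq_zero_iff_dvd _ _).mp (Fintype.linearIndependent_iff.mp hind _ h0 i)
  have hΦxy : Φ (x * y⁻¹) = 1 := by
    obtain ⟨t', rfl⟩ := htors t ht
    rw [hxy, map_mul, map_pow, hΦ, one_mul, map_prod]
    refine Finset.prod_eq_one fun i _ => ?_
    obtain ⟨k, hk⟩ := hn i
    rw [hk, mul_comm, zpow_mul, map_zpow, map_zpow, zpow_natCast, ← zpow_natCast, zpow_comm,
      zpow_natCast, hΦ, one_zpow]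
  rwa [map_mul, map_inv, hy, inv_one, mul_one] at hΦxy

/-- Apply `f` to `n`, written so that kernel reduction evaluates `n` to a literal first. -/
def evalThen {α : Type} (n : ℕ) (f : ℕ → α) : α :=
  Nat.rec (f 0) (fun k _ => f (Nat.succ k)) n

theorem evalThen_eq {α : Type} (n : ℕ) (f : ℕ → α) : evalThen n f = f n := by
  cases n <;> rfl

/-- Binary exponentiation modulo `m`: for `e < 2 ^ k` this is congruent to `acc * b ^ e`. -/
def powModAux (m k : ℕ) : ℕ → ℕ → ℕ → ℕ :=
  Nat.rec (fun _ _ acc => acc)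
    (fun _ ih b e acc => evalThen (b * b % m) fun b' =>
      evalThen (cond (Nat.beq (e % 2) 1) (acc * b % m) acc) fun acc' => ih b' (e / 2) acc') k

theorem powModAux_modEq (m k b e acc : ℕ) (he : e < 2 ^ k) :
    powModAux m k b e acc ≡ acc * b ^ e [MOD m] := by
  induction k generalizing b e acc with
  | zero =>
    obtain rfl : e = 0 := by simpa using he
    simpa [powModAux] using Nat.ModEq.refl _
  | succ k ih =>
    have h : powModAux m (k + 1) b e acc =
        powModAux m k (b * b % m) (e / 2) (cond (Nat.beq (e % 2) 1) (acc * b % m) acc) := by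
      simp only [powModAux, evalThen_eq]
    rw [h]
    refine (ih _ _ _ (by omega)).trans ?_
    have h1 : (b * b % m) ^ (e / 2) ≡ b ^ (2 * (e / 2)) [MOD m] := by
      rw [pow_mul, pow_two]
      exact (Nat.mod_modEq _ _).pow _
    rcases Nat.mod_two_eq_zero_or_one e with h2 | h2
    · have h3 : 2 * (e / 2) = e := by omega
      rw [h3] at h1
      rw [h2]
      exact h1.mul_left acc
    · have h3 : b ^ e = b * b ^ (2 * (e / 2)) := by
        rw [← pow_succ']
        congr 1
        omega
      rw [h3, ← mul_assoc, h2]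
      exact (Nat.mod_modEq (acc * b) m).mul h1

/-- Binary exponentiation modulo `m`, for exponents below `2 ^ 32`. -/
def powMod (m b e : ℕ) : ℕ := evalThen b fun b' => evalThen e fun e' => powModAux m 32 b' e' 1

theorem powMod_modEq (m b e : ℕ) (he : e < 2 ^ 32) : powMod m b e ≡ b ^ e [MOD m] := by
  simpa [powMod, evalThen_eq] using powModAux_modEq m 32 b e 1 he

theorem natCast_powMod (m b e : ℕ) (he : e < 2 ^ 32) :
    ((powMod m b e : ℕ) : ZMod m) = (b : ZMod m) ^ e := by
  exact_mod_cast (ZMod.natCast_eq_natCast_iff _ _ _).mpr (powMod_modEq m b e he)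

/-- The `k`-fold iterate of `x ↦ x ^ a` modulo `m`, starting at `b`. -/
def iterPowMod (m a k : ℕ) : ℕ → ℕ :=
  Nat.rec (fun b => b) (fun _ ih b => evalThen (powMod m b a) ih) k

theorem iterPowMod_modEq (m a k b : ℕ) (ha : a < 2 ^ 32) :
    iterPowMod m a k b ≡ b ^ a ^ k [MOD m] := by
  induction k generalizing b with
  | zero => simpa [iterPowMod] using Nat.ModEq.refl _
  | succ k ih =>
    have h : iterPowMod m a (k + 1) b = iterPowMod m a k (powMod m b a) := by
      simp only [iterPowMod, evalThen_eq]
    rw [h, pow_succ', pow_mul]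
    exact (ih _).trans (Nat.ModEq.pow _ (powMod_modEq m b a ha))

/-- The sum of `f` over `Finset.range n`, in a form suited to kernel reduction. -/
def sumBelow (f : ℕ → ℕ) (n : ℕ) : ℕ := Nat.rec 0 (fun k ih => ih + f k) n

theorem sumBelow_eq (f : ℕ → ℕ) (n : ℕ) : sumBelow f n = ∑ i ∈ Finset.range n, f i := by
  induction n with
  | zero => rfl
  | succ n ih => rw [Finset.sum_range_succ, ← ih]; rfl

/-- The product of `f` over `Finset.range n` modulo `m`, in a form suited to kernel reduction. -/
def prodModBelow (m : ℕ) (f : ℕ → ℕ) (n : ℕ) : ℕ := Nat.rec 1 (fun k ih => ih * f k % m) n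

theorem natCast_prodModBelow (m : ℕ) (f : ℕ → ℕ) (n : ℕ) :
    ((prodModBelow m f n : ℕ) : ZMod m) = ∏ i ∈ Finset.range n, (f i : ZMod m) := by
  induction n with
  | zero => simp [prodModBelow]
  | succ n ih =>
    rw [Finset.prod_range_succ, ← ih, ← Nat.cast_mul]
    exact ZMod.natCast_mod _ _

/-- Whether `f` holds at all naturals below `n`, in a form suited to kernel reduction. -/
def allBelow (f : ℕ → Bool) (n : ℕ) : Bool := Nat.rec true (fun k ih => f k && ih) n

theorem of_allBelow {f : ℕ → Bool} {n : ℕ} (h : allBelow f n = true) {i : ℕ} (hi : i < n) :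
    f i = true := by
  induction n with
  | zero => exact absurd hi i.not_lt_zero
  | succ n ih =>
    have h' : (f n && allBelow f n) = true := h
    rw [Bool.and_eq_true] at h'
    rcases Nat.lt_succ_iff_lt_or_eq.mp hi with hi | rfl
    · exact ih h'.2 hi
    · exact h'.1

theorem Nat.prime_pow_add_one_of_lucas {a k b q : ℕ} (ha : 1 < a) (ha' : a < 2 ^ 32)
    (hq : q = a ^ (k + 1) + 1) (h1 : powMod q (iterPowMod q a k b) a = 1)
    (h2 : ∀ r, r.Prime → r ∣ a → powMod q (iterPowMod q a k b) (a / r) % q ≠ 1) : q.Prime := by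
  have hq1 : q - 1 = a ^ k * a := by rw [hq, pow_succ, Nat.add_sub_cancel]
  have key : ∀ e, e ≤ a → (b : ZMod q) ^ (a ^ k * e) =
      ((powMod q (iterPowMod q a k b) e : ℕ) : ZMod q) := by
    intro e he
    rw [natCast_powMod _ _ _ (he.trans_lt ha'), pow_mul]
    congr 1
    exact_mod_cast ((ZMod.natCast_eq_natCast_iff _ _ _).mpr (iterPowMod_modEq q a k b ha')).symm
  refine lucas_primality q b ?_ fun r hr hrq => ?_
  · rw [hq1, key a le_rfl, h1, Nat.cast_one]
  · have hra : r ∣ a := by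
      rw [hq1, ← pow_succ] at hrq
      exact hr.dvd_of_dvd_pow hrq
    rw [hq1, Nat.mul_div_assoc _ hra, key _ (Nat.div_le_self _ _)]
    intro h
    have h3 : 1 < q := by
      rw [hq]
      have := Nat.one_le_pow (k + 1) a (by omega)
      omega
    refine h2 r hr hra ?_
    have h4 := (ZMod.natCast_eq_natCast_iff' _ 1 q).mp (h.trans Nat.cast_one.symm)
    rwa [Nat.mod_eq_of_lt h3] at h4

/-- A certificate check for `Nat.prime_pow_add_one_of_lucas`, where `rs` lists the prime factors
of `a`. -/
def lucasCheck (a k b : ℕ) (rs : List ℕ) : Bool :=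
  evalThen (a ^ (k + 1) + 1) fun q => evalThen (iterPowMod q a k b) fun t =>
    powMod q t a == 1 && rs.all fun r => !(powMod q t (a / r) % q == 1)

theorem Nat.prime_of_lucasCheck {a n k b q : ℕ} {rs : List ℕ} (h : lucasCheck a k b rs = true)
    (ha : 1 < a) (ha' : a < 2 ^ 32) (hn : n = k + 1) (hq : q = a ^ n + 1)
    (hrs : ∀ r, r.Prime → r ∣ a → r ∈ rs) : q.Prime := by
  subst hn
  rw [lucasCheck, evalThen_eq, evalThen_eq, ← hq] at h
  simp only [Bool.and_eq_true, Bool.not_eq_true', beq_iff_eq, beq_eq_false_iff_ne,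
    List.all_eq_true] at h
  exact Nat.prime_pow_add_one_of_lucas ha ha' hq h.1 fun r hr hra => h.2 r (hrs r hr hra)

theorem prime_genFermat {q : ℕ} (hq : q = 20483116 ^ 512 + 1) : q.Prime := by
  refine Nat.prime_of_lucasCheck (k := 511) (b := 3) (rs := [2, 1511, 3389]) (by decide +kernel)
    (by norm_num) (by norm_num) (by norm_num) hq fun r hr hra => ?_
  rw [show 20483116 = 2 ^ 2 * 1511 * 3389 by norm_num] at hra
  simp only [List.mem_cons, List.not_mem_nil, or_false]
  rcases (hr.dvd_mul.mp hra) with hra | hra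
  · rcases (hr.dvd_mul.mp hra) with hra | hra
    · exact .inl ((Nat.prime_dvd_prime_iff_eq hr Nat.prime_two).mp (hr.dvd_of_dvd_pow hra))
    · exact .inr (.inl ((Nat.prime_dvd_prime_iff_eq hr (by norm_num)).mp hra))
  · exact .inr (.inr ((Nat.prime_dvd_prime_iff_eq hr (by norm_num)).mp hra))

theorem natCast_powMod_add_one_pow {a b n k m q : ℕ} (hq : q = a ^ n + 1)
    (h : powMod m (powMod m a n + 1) k = b) (hn : n < 2 ^ 32) (hk : k < 2 ^ 32) :
    (q : ZMod m) ^ k = b := by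
  rw [← h, natCast_powMod _ _ _ hk, Nat.cast_add, natCast_powMod _ _ _ hn, hq, Nat.cast_add,
    Nat.cast_pow]

theorem genFermat_pow_eq_one {q : ℕ} (hq : q = 20483116 ^ 512 + 1) :
    (q : ZMod (1024 * 18433 ^ 2)) ^ 18432 = 1 := by
  rw [natCast_powMod_add_one_pow (b := 1) hq (by decide +kernel) (by norm_num) (by norm_num),
    Nat.cast_one]

theorem pow_eq_pow_of_modEq_of_pow_eq_one {M : Type*} [Monoid M] {x : M} {n a b : ℕ}
    (hx : x ^ n = 1) (h : a ≡ b [MOD n]) : x ^ a = x ^ b := by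
  rw [pow_eq_pow_mod a hx, pow_eq_pow_mod b hx, h]

/-- The product over `i < n` of `g (z ^ 3 ^ i) ^ ((p - 1) * c ^ i)` modulo `p ^ 2`, for `z` of
order dividing `1024`, in a form suited to kernel reduction. -/
def conjProd (p z c : ℕ) (g : ℕ → ℕ) (n : ℕ) : ℕ :=
  prodModBelow (p ^ 2) (fun i => evalThen (powMod (p ^ 2) z (powMod 1024 3 i % 1024)) fun y =>
    powMod (p ^ 2) (g y) ((p - 1) * (powMod p c i % p))) n

theorem isUnit_pow_pred_pow_eq_one {p : ℕ} (hp : p.Prime) {x : ZMod (p ^ 2)} (hx : IsUnit x) :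
    (x ^ (p - 1)) ^ p = 1 := by
  obtain ⟨u, rfl⟩ := hx
  rw [← pow_mul, ← Units.val_pow_eq_pow_val, mul_comm (p - 1)]
  have := ZMod.pow_totient u
  rw [Nat.totient_prime_pow hp two_pos, show 2 - 1 = 1 from rfl, pow_one] at this
  rw [this, Units.val_one]

theorem natCast_conjProd {p z c n : ℕ} {g : ℕ → ℕ} (hp : p.Prime) (hp' : p < 2 ^ 16)
    (hn : n < 2 ^ 32) (hz : (z : ZMod (p ^ 2)) ^ 1024 = 1) (x : ℕ → ZMod (p ^ 2))
    (hx : ∀ i y : ℕ, (y : ZMod (p ^ 2)) = z ^ 3 ^ i → (g y : ZMod (p ^ 2)) = x i)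
    (hxu : ∀ i, IsUnit (x i)) :
    (conjProd p z c g n : ZMod (p ^ 2)) = ∏ i ∈ Finset.range n, x i ^ ((p - 1) * c ^ i) := by
  rw [conjProd, natCast_prodModBelow]
  refine Finset.prod_congr rfl fun i hi => ?_
  have hi' : i < 2 ^ 32 := (Finset.mem_range.mp hi).trans hn
  have h1 : powMod p c i % p < p := Nat.mod_lt _ hp.pos
  have h2 : powMod 1024 3 i % 1024 < 1024 := Nat.mod_lt _ (by norm_num)
  have h3 : (p - 1) * (powMod p c i % p) < 2 ^ 32 :=
    (Nat.mul_lt_mul'' ((Nat.sub_le _ _).trans_lt hp') (h1.trans hp')).trans_eq (by norm_num)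
  rw [evalThen_eq, natCast_powMod _ _ _ h3, hx i, pow_mul, pow_mul]
  · exact pow_eq_pow_of_modEq_of_pow_eq_one (isUnit_pow_pred_pow_eq_one hp (hxu i))
      ((Nat.mod_modEq _ _).trans (powMod_modEq p c i hi'))
  · rw [natCast_powMod _ _ _ (h2.trans (by norm_num))]
    exact pow_eq_pow_of_modEq_of_pow_eq_one hz
      ((Nat.mod_modEq _ _).trans (powMod_modEq 1024 3 i hi'))

theorem prod_range_shift {G : Type*} [CommGroup G] {n : ℕ} (U : ℕ → G)
    (hU : ∀ k, U (k + n) = U k) (j : ℕ) :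
    ∏ i ∈ Finset.range n, U (i + j) = ∏ i ∈ Finset.range n, U i := by
  induction j with
  | zero => rfl
  | succ j ih =>
    rw [← ih]
    have h := (Finset.prod_range_succ' (fun i => U (i + j)) n).symm.trans
      (Finset.prod_range_succ (fun i => U (i + j)) n)
    rw [add_comm n j, hU, zero_add] at h
    simpa only [add_assoc, add_comm, add_left_comm] using mul_right_cancel h

theorem prod_range_shift_pow_eq_one {G : Type*} [CommGroup G] {p c n : ℕ} (T : ℕ → G)
    (hT : ∀ k, T k ^ p = 1) (hTn : ∀ k, T (k + n) = T k) (hn : n ≠ 0) (hc : c ^ n ≡ 1 [MOD p])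
    (h : ∏ i ∈ Finset.range n, T i ^ c ^ i = 1) (j : ℕ) :
    ∏ i ∈ Finset.range n, T (i + j) ^ c ^ i = 1 := by
  set Y := ∏ i ∈ Finset.range n, T (i + j) ^ c ^ i with hY
  have h1 : Y ^ c ^ j = 1 := by
    rw [hY, ← Finset.prod_pow, ← h, ← prod_range_shift (fun k => T k ^ c ^ k) _ j]
    · refine Finset.prod_congr rfl fun i _ => ?_
      rw [← pow_mul, ← pow_add]
    · intro k
      rw [hTn]
      refine pow_eq_pow_of_modEq_of_pow_eq_one (hT k) ?_
      rw [pow_add]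
      simpa using hc.mul_left (c ^ k)
  have h2 : Y ^ p = 1 := by
    rw [hY, ← Finset.prod_pow]
    refine Finset.prod_eq_one fun i _ => ?_
    rw [← pow_mul, mul_comm, pow_mul, hT, one_pow]
  have hcp : (c ^ j).Coprime p := by
    refine Nat.Coprime.pow_left j ((Nat.coprime_pow_left_iff (Nat.pos_of_ne_zero hn) c p).mp ?_)
    rw [Nat.Coprime, hc.gcd_eq, Nat.gcd_one_left]
  have h3 := orderOf_dvd_of_pow_eq_one h1
  have h4 := orderOf_dvd_of_pow_eq_one h2
  exact orderOf_eq_one_iff.mp (Nat.eq_one_of_dvd_coprimes hcp h3 h4)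

theorem absNorm_modEq_one_of_isPrimitiveRoot {L : Type*} [Field L] [NumberField L] {m : ℕ}
    [NeZero m] {ξ : 𝓞 L} (hξ : IsPrimitiveRoot ξ m) (I : Ideal (𝓞 L)) :
    (Ideal.absNorm I).Coprime m → Ideal.absNorm I ≡ 1 [MOD m] := by
  induction I using UniqueFactorizationMonoid.induction_on_prime with
  | h₁ =>
    intro h
    simp only [Ideal.zero_eq_bot, Ideal.absNorm_bot, Nat.coprime_zero_left] at h
    subst h
    exact Nat.modEq_one
  | h₂ I hI =>
    intro _
    rw [Ideal.isUnit_iff] at hI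
    simp [hI, Nat.ModEq.refl]
  | h₃ I P hI hP ih =>
    intro h
    rw [map_mul] at h ⊢
    have hP0 := hP.ne_zero
    have hPp : P.IsPrime := Ideal.isPrime_of_prime hP
    have : P.IsMaximal := Ring.DimensionLEOne.maximalOfPrime hP0 hPp
    let _ := Ideal.Quotient.field P
    have hN : Ideal.absNorm P ≠ 1 := Ideal.absNorm_eq_one_iff.not.mpr hPp.ne_top
    have hprim := hξ.idealQuotient_mk hN h.coprime_mul_right
    have hdvd : m ∣ Ideal.absNorm P - 1 := by
      have h1 := (hprim.isUnit_unit (NeZero.ne m)).eq_orderOf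
      rw [h1]
      have := orderOf_dvd_natCard (hprim.isUnit (NeZero.ne m)).unit
      rwa [Nat.card_units] at this
    have h1 : Ideal.absNorm P ≡ 1 [MOD m] :=
      ((Nat.modEq_iff_dvd' (Nat.one_le_iff_ne_zero.mpr
        (Ideal.absNorm_eq_zero_iff.not.mpr hP0))).mpr hdvd).symm
    simpa using h1.mul (ih h.coprime_mul_left)

theorem IsPrimitiveRoot.mul_of_coprime {R : Type*} [CommRing R] {n m : ℕ} (hnm : n.Coprime m)
    {a b : R} (ha : IsPrimitiveRoot a n) (hb : IsPrimitiveRoot b m) :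
    IsPrimitiveRoot (a * b) (n * m) := by
  rw [ha.eq_orderOf, hb.eq_orderOf, ← (Commute.all a b).orderOf_mul_eq_mul_orderOf_of_coprime]
  · exact IsPrimitiveRoot.orderOf _
  · rwa [← ha.eq_orderOf, ← hb.eq_orderOf]

theorem adjoin_root_eq_top_of_coprime {n m : ℕ} [NeZero n] [NeZero m] (hnm : n.Coprime m)
    {F M : Type*} [Field F] [NumberField F] [Field M] [NumberField M] [Algebra F M]
    [IsCyclotomicExtension {n} ℚ F] [IsCyclotomicExtension {n * m} ℚ M]
    {ξ : M} (hξ : IsPrimitiveRoot ξ m) : Algebra.adjoin F {ξ} = ⊤ := by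
  have hζ := IsCyclotomicExtension.zeta_spec n ℚ F
  have hω := IsPrimitiveRoot.mul_of_coprime hnm
    (hζ.map_of_injective (algebraMap F M).injective) hξ
  have : NeZero (n * m) := ⟨mul_ne_zero (NeZero.ne n) (NeZero.ne m)⟩
  have h1 := IsCyclotomicExtension.adjoin_primitive_root_eq_top (A := ℚ) hω
  have h2 : (⊤ : Subalgebra ℚ M) ≤ (Algebra.adjoin F {ξ}).restrictScalars ℚ := by
    rw [← h1, Algebra.adjoin_le_iff, Set.singleton_subset_iff]
    exact mul_mem (S := Subalgebra F M) (Subalgebra.algebraMap_mem (Algebra.adjoin F {ξ}) _)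
      (Algebra.self_mem_adjoin_singleton F ξ)
  exact eq_top_iff.mpr fun x _ => h2 (Algebra.mem_top (R := ℚ))

theorem minpoly_eq_cyclotomic_of_coprime {n m : ℕ} [NeZero n] [NeZero m] (hnm : n.Coprime m)
    {F M : Type*} [Field F] [NumberField F] [Field M] [NumberField M] [Algebra F M]
    [IsCyclotomicExtension {n} ℚ F] [IsCyclotomicExtension {n * m} ℚ M]
    {ξ : M} (hξ : IsPrimitiveRoot ξ m) : minpoly F ξ = cyclotomic m F := by
  have : NeZero (n * m) := ⟨mul_ne_zero (NeZero.ne n) (NeZero.ne m)⟩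
  have htop := adjoin_root_eq_top_of_coprime (F := F) hnm hξ
  have hdeg : Module.finrank F M = m.totient := by
    have h1 := Module.finrank_mul_finrank ℚ F M
    rw [IsCyclotomicExtension.Rat.finrank n F, IsCyclotomicExtension.Rat.finrank (n * m) M,
      Nat.totient_mul hnm] at h1
    exact Nat.eq_of_mul_eq_mul_left (Nat.totient_pos.mpr (NeZero.pos n)) h1
  have hξi : IsIntegral F ξ := Algebra.IsIntegral.isIntegral ξ
  have hdeg2 : (minpoly F ξ).natDegree = m.totient := by
    rw [← hdeg, (PowerBasis.ofAdjoinEqTop hξi htop).finrank, PowerBasis.ofAdjoinEqTop_dim]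
  have hdvd : minpoly F ξ ∣ cyclotomic m F := by
    refine minpoly.dvd _ _ ?_
    rw [aeval_def, eval₂_eq_eval_map, map_cyclotomic]
    exact hξ.isRoot_cyclotomic (NeZero.pos m)
  refine (Polynomial.eq_of_monic_of_dvd_of_natDegree_le (minpoly.monic hξi)
    (cyclotomic.monic m F) hdvd ?_).symm
  rw [natDegree_cyclotomic, hdeg2]

/-- The companion matrix of a monic polynomial of degree `n`. -/
def companionMatrix {A : Type*} [CommRing A] (n : ℕ) (P : A[X]) : Matrix (Fin n) (Fin n) A :=
  Matrix.of fun i j => if (j : ℕ) + 1 = n then -P.coeff i else if (i : ℕ) = j + 1 then 1 else 0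

/-- For monic `P` of degree `n` this is the norm of the class of `f` in `A[X] / P`. -/
noncomputable def companionNorm {A : Type*} [CommRing A] (n : ℕ) (P f : A[X]) : A :=
  (aeval (companionMatrix n P) f).det

theorem map_companionNorm {A B : Type*} [CommRing A] [CommRing B] (φ : A →+* B) (n : ℕ)
    (P f : A[X]) : φ (companionNorm n P f) = companionNorm n (P.map φ) (f.map φ) := by
  have h : φ.mapMatrix (companionMatrix n P) = companionMatrix n (P.map φ) := by
    ext i j
    simp only [companionMatrix, RingHom.mapMatrix_apply, Matrix.map_apply, Matrix.of_apply,
      coeff_map]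
    split_ifs <;> simp
  rw [companionNorm, RingHom.map_det, map_aeval_eq_aeval_map (φ := φ), h, companionNorm]
  ext x : 1
  simp only [RingHom.coe_comp, Function.comp_apply, Matrix.algebraMap_eq_diagonal]
  ext i j
  simp [Matrix.diagonal_apply, apply_ite φ]

theorem PowerBasis.norm_aeval_gen {A S : Type*} [CommRing A] [CommRing S] [Algebra A S]
    [IsDomain A] (pb : PowerBasis A S) (f : A[X]) {P : A[X]} (hP : minpoly A pb.gen = P) :
    Algebra.norm A (aeval pb.gen f) = companionNorm P.natDegree P f := by
  subst hP
  rw [pb.natDegree_minpoly, Algebra.norm_eq_matrix_det pb.basis, companionNorm]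
  congr 1
  rw [← aeval_algHom_apply, pb.leftMulMatrix, pb.minpolyGen_eq]
  rfl

theorem norm_aeval_zeta_modEq {C : Type*} [Field C] [NumberField C] {m : ℕ} [NeZero m]
    [IsCyclotomicExtension {m} ℚ C] (f : ℤ[X])
    (hf : IsUnit ((companionNorm m.totient (cyclotomic m ℤ) f : ℤ) : ZMod m)) :
    ((companionNorm m.totient (cyclotomic m ℤ) f : ℤ) : ZMod m) ^ 2 = 1 := by
  have hξ := IsCyclotomicExtension.zeta_spec m ℚ C
  have h1 := hξ.integralPowerBasis.norm_aeval_gen f (P := cyclotomic m ℤ) (by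
    rw [hξ.integralPowerBasis_gen, ← NumberField.RingOfIntegers.minpoly_coe]
    exact (cyclotomic_eq_minpoly hξ (NeZero.pos m)).symm)
  rw [natDegree_cyclotomic] at h1
  rw [← h1] at hf ⊢
  set b := aeval hξ.integralPowerBasis.gen f
  have h2 : (Ideal.absNorm (Ideal.span {b}) : ℤ) = |Algebra.norm ℤ b| := by
    rw [Ideal.absNorm_span_singleton, Int.natCast_natAbs]
  have h3 : ((Ideal.absNorm (Ideal.span {b}) : ℕ) : ZMod m) ^ 2 =
      ((Algebra.norm ℤ b : ℤ) : ZMod m) ^ 2 := by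
    have := congrArg (fun x : ℤ => (x : ZMod m) ^ 2) h2
    simp only [Int.cast_natCast] at this
    rw [this, ← Int.cast_pow, sq_abs, Int.cast_pow]
  have h4 : (Ideal.absNorm (Ideal.span {b})).Coprime m := by
    rw [← ZMod.isUnit_iff_coprime, ← isUnit_pow_iff two_ne_zero, h3]
    exact hf.pow 2
  have h5 := absNorm_modEq_one_of_isPrimitiveRoot hξ.toInteger_isPrimitiveRoot _ h4
  rw [← h3, (ZMod.natCast_eq_natCast_iff _ _ _).mpr h5]
  simp

theorem norm_cyclotomic_sq_eq_one {n m : ℕ} [NeZero n] [NeZero m] (hnm : n.Coprime m)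
    {F M : Type*} [Field F] [NumberField F] [Field M] [NumberField M] [Algebra F M]
    [IsCyclotomicExtension {n} ℚ F] [IsCyclotomicExtension {n * m} ℚ M]
    (α : 𝓞 M) (ν : 𝓞 F) (hν : (ν : F) = Algebra.norm F (α : M)) (r : 𝓞 F →+* ZMod m)
    (hr : IsUnit (r ν)) : r ν ^ 2 = 1 := by
  have : NeZero (n * m) := ⟨mul_ne_zero (NeZero.ne n) (NeZero.ne m)⟩
  have hζ := IsCyclotomicExtension.zeta_spec n ℚ F
  have hξ : IsPrimitiveRoot (IsCyclotomicExtension.zeta (n * m) ℚ M ^ n) m :=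
    (IsCyclotomicExtension.zeta_spec (n * m) ℚ M).pow (NeZero.pos _) rfl
  set ξ := IsCyclotomicExtension.zeta (n * m) ℚ M ^ n
  have hω := IsPrimitiveRoot.mul_of_coprime hnm
    (hζ.map_of_injective (algebraMap F M).injective) hξ
  obtain ⟨g, hg⟩ : ∃ g : ℤ[X], aeval hω.toInteger g = α := by
    have := IsCyclotomicExtension.Rat.adjoin_singleton_eq_top hω
    rw [Algebra.adjoin_singleton_eq_range_aeval] at this
    exact (AlgHom.range_eq_top _).mp this α
  let f : (𝓞 F)[X] := (g.map (algebraMap ℤ (𝓞 F))).comp (C hζ.toInteger * X)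
  have hf : aeval ξ (f.map (algebraMap (𝓞 F) F)) = (α : M) := by
    have h1 : (α : M) = aeval (algebraMap F M (IsCyclotomicExtension.zeta n ℚ F) * ξ) g := by
      rw [← hg, RingOfIntegers.coe_eq_algebraMap, ← aeval_algebraMap_apply]
      rfl
    rw [h1, aeval_map_algebraMap, aeval_comp, aeval_map_algebraMap]
    congr 2
    simp only [map_mul, aeval_C, aeval_X]
    rfl
  have hξi : IsIntegral F ξ := Algebra.IsIntegral.isIntegral ξ
  have hmin := minpoly_eq_cyclotomic_of_coprime (F := F) hnm hξ
  have h1 := (PowerBasis.ofAdjoinEqTop hξi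
    (adjoin_root_eq_top_of_coprime (F := F) hnm hξ)).norm_aeval_gen
      (f.map (algebraMap (𝓞 F) F)) (P := cyclotomic m F) hmin
  rw [PowerBasis.ofAdjoinEqTop_gen, hf, ← hν, natDegree_cyclotomic,
    ← map_cyclotomic m (algebraMap (𝓞 F) F), ← map_companionNorm] at h1
  have h2 : ν = companionNorm m.totient (cyclotomic m (𝓞 F)) f :=
    RingOfIntegers.coe_injective h1
  obtain ⟨f', hf'⟩ := Polynomial.map_surjective (Int.castRingHom (ZMod m))
    (ZMod.ringHom_surjective _) (f.map r)
  have h3 : r ν = ((companionNorm m.totient (cyclotomic m ℤ) f' : ℤ) : ZMod m) := by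
    rw [h2, map_companionNorm, map_cyclotomic, ← hf', ← map_cyclotomic m (Int.castRingHom _),
      ← map_companionNorm]
    rfl
  rw [h3] at hr ⊢
  have : @IsCyclotomicExtension {m} ℚ (CyclotomicField m ℚ) _ _ DivisionRing.toRatAlgebra := by
    rw [Subsingleton.elim (DivisionRing.toRatAlgebra : Algebra ℚ (CyclotomicField m ℚ))
      (CyclotomicField.algebra m ℚ)]
    exact CyclotomicField.isCyclotomicExtension m ℚ
  exact norm_aeval_zeta_modEq (C := CyclotomicField m ℚ) f' hr
theorem exists_relNorm_eq_pow_of_absNorm_prime {N : ℕ} [NeZero N] {F M : Type*} [Field F]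
    [NumberField F] [Field M] [NumberField M] [Algebra F M] [IsCyclotomicExtension {N} ℚ M]
    {q : ℕ} (hq : q.Prime) (hqN : ¬ q ∣ N) (I : Ideal (𝓞 F)) (hI : Ideal.absNorm I = q) :
    ∃ (Q : Ideal (𝓞 M)) (f : ℕ), Q ≠ ⊥ ∧ f ∣ orderOf (q : ZMod N) ∧
      Ideal.relNorm (𝓞 F) Q = I ^ f := by
  have hqF : Fact q.Prime := ⟨hq⟩
  have hIp : I.IsPrime := Ideal.isPrime_of_irreducible_absNorm (by rw [hI]; exact hq)
  have hI0 : I ≠ ⊥ := by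
    rintro rfl
    rw [Ideal.absNorm_bot] at hI
    exact hq.ne_zero hI.symm
  have hIm : I.IsMaximal := hIp.isMaximal hI0
  obtain ⟨Q, hQ, hQI⟩ := Ideal.exists_maximal_ideal_liesOver_of_isIntegral (S := 𝓞 M) I
  have hIq : I.LiesOver (Ideal.span {(q : ℤ)}) := by
    refine ⟨?_⟩
    have h1 : (Ideal.span {(q : ℤ)}).IsMaximal :=
      ((Ideal.span_singleton_prime (by exact_mod_cast hq.ne_zero)).mpr
        (Nat.prime_iff_prime_int.mp hq)).isMaximal (by simpa using hq.ne_zero)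
    refine h1.eq_of_le ?_ ?_
    · exact (Ideal.IsPrime.under ℤ I).ne_top
    · rw [Ideal.span_singleton_le_iff_mem, Ideal.under_def, Ideal.mem_comap]
      simpa [hI] using Ideal.absNorm_mem I
  have hQq : Q.LiesOver (Ideal.span {(q : ℤ)}) := Ideal.LiesOver.trans Q I _
  refine ⟨Q, Q.inertiaDeg (𝓞 F), ?_, ?_, Ideal.relNorm_eq_pow_of_isMaximal Q I⟩
  · exact Ideal.ne_bot_of_liesOver_of_ne_bot hI0 Q
  · rw [← IsCyclotomicExtension.Rat.inertiaDeg_eq_of_not_dvd q M Q hqN,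
      Ideal.inertiaDeg_tower (R := ℤ) I Q]
    exact Dvd.intro_left _ rfl

theorem isPrincipal_pow_card_classGroup {R : Type*} [CommRing R] [IsDedekindDomain R]
    {J : Ideal R} (hJ : J ≠ ⊥) : ∃ α, J ^ Nat.card (ClassGroup R) = Ideal.span {α} := by
  have hJ' : J ∈ nonZeroDivisors (Ideal R) := mem_nonZeroDivisors_of_ne_zero hJ
  have h1 : ClassGroup.mk0 (⟨J, hJ'⟩ ^ Nat.card (ClassGroup R)) = 1 := by
    rw [map_pow, pow_card_eq_one']
  exact (Submodule.isPrincipal_iff _).mp ((ClassGroup.mk0_eq_one_iff (pow_mem hJ' _)).mp h1)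

open Algebra in
theorem exists_intNorm_eq_unit_mul_pow {F F' K M : Type*} [Field F] [NumberField F]
    [Field F'] [NumberField F'] [Field K] [NumberField K] [Field M] [NumberField M]
    [Algebra F F'] [Algebra F K] [Algebra F M] [Algebra F' M] [Algebra K M]
    [IsScalarTower F F' M] [IsScalarTower F K M] {N : ℕ} [NeZero N]
    [IsCyclotomicExtension {N} ℚ M] (π : 𝓞 F')
    (hq : (Ideal.absNorm (Ideal.span {π})).Prime) (hqN : ¬ Ideal.absNorm (Ideal.span {π}) ∣ N) :
    ∃ (f : ℕ) (α : 𝓞 K) (u : (𝓞 F)ˣ), f ∣ orderOf (Ideal.absNorm (Ideal.span {π}) : ZMod N) ∧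
      intNorm (𝓞 F) (𝓞 K) α =
        u * intNorm (𝓞 F) (𝓞 F') π ^ (f * Nat.card (ClassGroup (𝓞 K))) := by
  obtain ⟨Q, f, hQ0, hf, hQ⟩ := exists_relNorm_eq_pow_of_absNorm_prime (M := M) hq hqN _ rfl
  obtain ⟨α, hα⟩ := isPrincipal_pow_card_classGroup (J := Ideal.relNorm (𝓞 K) Q)
    (by rwa [Ne, Ideal.relNorm_eq_bot_iff])
  have h1 : Ideal.relNorm (𝓞 F) (Ideal.span {α}) =
      Ideal.relNorm (𝓞 F) (Ideal.span {π}) ^ (f * Nat.card (ClassGroup (𝓞 K))) := by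
    rw [← hα, map_pow, Ideal.relNorm_relNorm, pow_mul,
      ← map_pow (Ideal.relNorm (𝓞 F)) (Ideal.span {π}), ← hQ, Ideal.relNorm_relNorm]
  rw [Ideal.relNorm_singleton, Ideal.relNorm_singleton, Ideal.span_singleton_pow,
    Ideal.span_singleton_eq_span_singleton] at h1
  obtain ⟨u, hu⟩ := h1.symm
  exact ⟨f, α, u, hf, by rw [← hu, mul_comm]⟩

open Algebra in
theorem exists_unit_forall_ringHom_pow_eq_one {F F' K M : Type*} [Field F] [NumberField F]
    [Field F'] [NumberField F'] [Field K] [NumberField K] [Field M] [NumberField M]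
    [Algebra F F'] [Algebra F K] [Algebra F M] [Algebra F' M] [Algebra K M]
    [IsScalarTower F F' M] [IsScalarTower F K M] [IsGalois F F'] {n m : ℕ} [NeZero n] [NeZero m]
    (hnm : n.Coprime m) [IsCyclotomicExtension {n} ℚ F'] [IsCyclotomicExtension {n * m} ℚ M]
    (π : 𝓞 F') (hq : (Ideal.absNorm (Ideal.span {π})).Prime)
    (hqN : ¬ Ideal.absNorm (Ideal.span {π}) ∣ n * m)
    (hπ : ∀ r : 𝓞 F' →+* ZMod m, IsUnit (r (algebraMap (𝓞 F) (𝓞 F') (intNorm (𝓞 F) (𝓞 F') π)))) :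
    ∃ (f : ℕ) (u : (𝓞 F')ˣ),
      f ∣ orderOf (Ideal.absNorm (Ideal.span {π}) : ZMod (n * m)) ∧
      ∀ r : 𝓞 F' →+* ZMod m,
        r (u * algebraMap (𝓞 F) (𝓞 F') (intNorm (𝓞 F) (𝓞 F') π) ^
          (f * Nat.card (ClassGroup (𝓞 K)))) ^ (2 * Module.finrank K M) = 1 := by
  have : NeZero (n * m) := ⟨mul_ne_zero (NeZero.ne n) (NeZero.ne m)⟩
  obtain ⟨f, α, u, hf, hα⟩ :=
    exists_intNorm_eq_unit_mul_pow (F := F) (K := K) (M := M) (N := n * m) π hq hqN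
  refine ⟨f, Units.map (algebraMap (𝓞 F) (𝓞 F')).toMonoidHom u, hf, fun r => ?_⟩
  set γ := algebraMap (𝓞 F) (𝓞 F') (intNorm (𝓞 F) (𝓞 F') π)
  have h1 : ((Units.map (algebraMap (𝓞 F) (𝓞 F')).toMonoidHom u : (𝓞 F')ˣ) : 𝓞 F') *
      γ ^ (f * Nat.card (ClassGroup (𝓞 K))) =
      algebraMap (𝓞 F) (𝓞 F') (intNorm (𝓞 F) (𝓞 K) α) := by
    rw [hα, map_mul, map_pow]
    rfl
  have hunit : IsUnit (r (algebraMap (𝓞 F) (𝓞 F') (intNorm (𝓞 F) (𝓞 K) α))) := by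
    rw [← h1, map_mul, map_pow]
    exact ((Units.isUnit _).map r).mul ((hπ r).pow _)
  rw [h1, mul_comm 2, pow_mul]
  set ν := intNorm (𝓞 F') (𝓞 M) (algebraMap (𝓞 K) (𝓞 M) α)
  have h2 : intNorm (𝓞 F) (𝓞 F') ν = intNorm (𝓞 F) (𝓞 K) α ^ Module.finrank K M := by
    apply RingOfIntegers.coe_injective
    rw [intNorm_intNorm, map_pow, algebraMap_intNorm (L := M), algebraMap_intNorm (L := K),
      ← norm_norm (S := K), ← map_pow, ← Algebra.norm_algebraMap]
    rfl
  have h3 : algebraMap (𝓞 F) (𝓞 F') (intNorm (𝓞 F) (𝓞 F') ν) =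
      ∏ s : F' ≃ₐ[F] F', RingOfIntegers.mapRingHom (s : F' →+* F') ν := by
    apply RingOfIntegers.coe_injective
    rw [map_prod]
    have := norm_eq_prod_automorphisms F (ν : F')
    rw [← algebraMap_intNorm (A := 𝓞 F) (B := 𝓞 F')] at this
    exact this
  rw [← map_pow r, ← map_pow (algebraMap (𝓞 F) (𝓞 F')), ← h2, h3, map_prod, ← Finset.prod_pow]
  rw [← isUnit_pow_iff Module.finrank_pos.ne' (n := Module.finrank K M), ← map_pow r,
    ← map_pow (algebraMap (𝓞 F) (𝓞 F')), ← h2, h3, map_prod] at hunit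
  refine Finset.prod_eq_one fun s _ => ?_
  refine norm_cyclotomic_sq_eq_one hnm (algebraMap (𝓞 K) (𝓞 M) α) ν (algebraMap_intNorm _)
    (r.comp (RingOfIntegers.mapRingHom (s : F' →+* F'))) ?_
  exact isUnit_of_dvd_unit (Finset.dvd_prod_of_mem
    (fun s : F' ≃ₐ[F] F' => r (RingOfIntegers.mapRingHom (s : F' →+* F') ν))
    (Finset.mem_univ s)) hunit

theorem exists_monoidHom_multiplicative_zmod {R : Type*} [CommRing R] [IsDomain R] {p N : ℕ}
    [Fact p.Prime] (hN : ∀ x : Rˣ, x ^ (N * p) = 1) {g : Rˣ} (hg : orderOf g = p) :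
    ∃ d : Rˣ →* Multiplicative (ZMod p), ∀ (x : Rˣ) (n : ℕ), x ^ N = g ^ n →
      d x = Multiplicative.ofAdd (n : ZMod p) := by
  have hp := (Fact.out : p.Prime)
  have hgR : IsPrimitiveRoot (g : R) p := by
    rw [IsPrimitiveRoot.coe_units_iff, ← hg]
    exact IsPrimitiveRoot.orderOf g
  have hx : ∀ x : Rˣ, ∃ n : ℕ, x ^ N = g ^ n := by
    intro x
    have : NeZero p := ⟨hp.ne_zero⟩
    obtain ⟨n, -, hn⟩ := hgR.eq_pow_of_pow_eq_one (ξ := ((x ^ N : Rˣ) : R))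
      (by rw [← Units.val_pow_eq_pow_val, ← pow_mul, hN, Units.val_one])
    exact ⟨n, Units.ext (by rw [← hn, Units.val_pow_eq_pow_val])⟩
  choose f hf using hx
  have key : ∀ a b : ℕ, g ^ a = g ^ b → (a : ZMod p) = b := by
    intro a b h
    rw [ZMod.natCast_eq_natCast_iff, ← hg]
    exact pow_eq_pow_iff_modEq.mp h
  refine ⟨MonoidHom.mk' (fun x => Multiplicative.ofAdd (f x : ZMod p)) fun x y => ?_,
    fun x n hn => ?_⟩
  · rw [← ofAdd_add, ← Nat.cast_add]
    exact congrArg _ (key _ _ (by rw [← hf, mul_pow, hf, hf, pow_add]))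
  · exact congrArg Multiplicative.ofAdd (key _ _ (by rw [← hf, hn]))

theorem le_finrank_span_of_circulant {k : Type*} [Field k] {n : ℕ} (b : ℕ → Fin n → k)
    (v w : ℕ → k) (c : k) (hb : ∀ i j, b i j = v (i + j)) (hv : ∀ i, v (i + n) = v i)
    (h : ∀ i < n, ∑ j ∈ Finset.range n, w j * v (i + j) = (if i = 0 then 1 else 0) - c) :
    n - 1 ≤ Module.finrank k (Submodule.span k (Set.range b)) := by
  set S := Submodule.span k (Set.range b) with hS
  set T := Submodule.span k {fun _ : Fin n => c} with hT
  have hv' : ∀ i, ∑ j ∈ Finset.range n, w j * v (i + n + j) =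
      ∑ j ∈ Finset.range n, w j * v (i + j) := by
    intro i
    refine Finset.sum_congr rfl fun j _ => ?_
    rw [add_right_comm, hv]
  have h1 : ∀ i : Fin n, Pi.single i (1 : k) - (fun _ => c) ∈ S := by
    intro i
    have h2 : Pi.single i (1 : k) - (fun _ => c) =
        ∑ j ∈ Finset.range n, w j • b (n - i + j) := by
      ext l
      have hi := i.isLt
      have hl := l.isLt
      rw [Finset.sum_apply, Pi.sub_apply]
      simp only [Pi.smul_apply, hb, smul_eq_mul]
      have h3 : ∑ j ∈ Finset.range n, w j * v (n - i + j + l) =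
          ∑ j ∈ Finset.range n, w j * v (n - i + l + j) :=
        Finset.sum_congr rfl fun j _ => by rw [add_right_comm]
      rw [h3]
      rcases lt_or_ge l i with hli | hli
      · have hli' : (l : ℕ) < i := hli
        rw [h _ (by omega), if_neg (by omega), Pi.single_eq_of_ne hli.ne]
      · have hli' : (i : ℕ) ≤ l := hli
        rw [show n - i + l = l - i + n by omega, hv', h _ (by omega)]
        rcases eq_or_lt_of_le hli with rfl | hlt
        · simp
        · have hlt' : (i : ℕ) < l := hlt
          rw [if_neg (by omega), Pi.single_eq_of_ne hlt.ne']
    rw [h2]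
    exact Submodule.sum_mem _ fun j _ => Submodule.smul_mem _ _ (Submodule.subset_span ⟨_, rfl⟩)
  have h2 : S ⊔ T = ⊤ := by
    rw [eq_top_iff, ← (Pi.basisFun k (Fin n)).span_eq, Submodule.span_le]
    rintro _ ⟨i, rfl⟩
    rw [Pi.basisFun_apply, ← sub_add_cancel (Pi.single i (1 : k)) (fun _ => c)]
    exact Submodule.add_mem_sup (h1 i) (Submodule.subset_span rfl)
  have h3 := Submodule.finrank_add_le_finrank_add_finrank S T
  have h4 : Module.finrank k T ≤ 1 := by
    simpa using finrank_span_le_card (R := k) ({fun _ : Fin n => c} : Set (Fin n → k))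
  rw [h2, finrank_top, Module.finrank_fin_fun] at h3
  omega

/-- The `i`-th digit of `n` in base `2 ^ 15`. -/
def digit (n i : ℕ) : ℕ := n / 2 ^ (15 * i) % 2 ^ 15

/-- Whether `(1 + y + y ^ 2) ^ N = g ^ digit V i` modulo `l` for each `y = η ^ 3 ^ i`, `i < n`. -/
def logCheck (l η g V N n : ℕ) : Bool :=
  allBelow (fun i => evalThen (powMod l η (powMod 1024 3 i % 1024)) fun y =>
    powMod l (1 + y + y * y) N % l == powMod l g (digit V i) % l) n

theorem pow_eq_pow_of_logCheck {l η g V N n : ℕ} (h : logCheck l η g V N n = true)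
    (hη : (η : ZMod l) ^ 1024 = 1) (hN : N < 2 ^ 32) (hn : n < 2 ^ 32) {i : ℕ} (hi : i < n) :
    (1 + (η : ZMod l) ^ 3 ^ i + (η ^ 3 ^ i) ^ 2) ^ N = (g : ZMod l) ^ digit V i := by
  have h1 := of_allBelow h hi
  rw [evalThen_eq, beq_iff_eq] at h1
  have h2 := (ZMod.natCast_eq_natCast_iff' _ _ l).mpr h1
  have h3 : powMod 1024 3 i % 1024 < 1024 := Nat.mod_lt _ (by norm_num)
  have h4 : digit V i < 2 ^ 15 := Nat.mod_lt _ (by norm_num)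
  rw [natCast_powMod _ _ _ hN, natCast_powMod _ _ _ (h4.trans (by norm_num)), Nat.cast_add,
    Nat.cast_add, Nat.cast_mul, natCast_powMod _ _ _ (h3.trans (by norm_num)),
    pow_eq_pow_of_modEq_of_pow_eq_one hη
      ((Nat.mod_modEq _ _).trans (powMod_modEq 1024 3 i (hi.trans hn))), Nat.cast_one] at h2
  rw [← h2, pow_two]

/-- Whether the circulant matrix of the digits `i < n` of `V` is inverted modulo `p`, up to
adding a constant `c`, by the digits of `W`. -/
def circulantCheck (p V W c n : ℕ) : Bool :=
  allBelow (fun i => (sumBelow (fun j => digit W j * digit V ((i + j) % n)) n + c) % p ==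
    cond (i == 0) 1 0) n

theorem sum_of_circulantCheck {p V W c n : ℕ} [Fact (1 < p)]
    (h : circulantCheck p V W c n = true) {i : ℕ} (hi : i < n) :
    ∑ j ∈ Finset.range n, (digit W j : ZMod p) * digit V ((i + j) % n) =
      (if i = 0 then 1 else 0) - c := by
  have h1 := of_allBelow h hi
  rw [beq_iff_eq, sumBelow_eq] at h1
  have h2 := congrArg (Nat.cast : ℕ → ZMod p) h1
  rw [ZMod.natCast_mod] at h2
  push_cast at h2
  rw [eq_sub_iff_add_eq, h2]
  by_cases hi0 : i = 0
  · rw [hi0, if_pos rfl]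
    exact Nat.cast_one
  · rw [if_neg hi0, beq_eq_false_iff_ne.mpr hi0]
    exact Nat.cast_zero

/-- The character `x ↦ ∏ i < n, r i x ^ ((p - 1) * c ^ i)` attached to homomorphisms `r i` to
`ZMod (p ^ 2)`. -/
def conjChar {R : Type*} [CommRing R] (p c n : ℕ) (r : ℕ → R →+* ZMod (p ^ 2)) :
    R →* ZMod (p ^ 2) :=
  ∏ i ∈ Finset.range n, (r i : R →* ZMod (p ^ 2)) ^ ((p - 1) * c ^ i)

theorem conjChar_apply {R : Type*} [CommRing R] (p c n : ℕ) (r : ℕ → R →+* ZMod (p ^ 2)) (x : R) :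
    conjChar p c n r x = ∏ i ∈ Finset.range n, r i x ^ ((p - 1) * c ^ i) := by
  simp [conjChar, MonoidHom.finsetProd_apply]

theorem conjChar_pow_eq_one {R : Type*} [CommRing R] {p c n : ℕ} (hp : p.Prime)
    {r : ℕ → R →+* ZMod (p ^ 2)} {x : R} (hx : ∀ i, IsUnit (r i x)) :
    conjChar p c n r x ^ p = 1 := by
  rw [conjChar_apply, ← Finset.prod_pow]
  refine Finset.prod_eq_one fun i _ => ?_
  rw [pow_mul, pow_right_comm, isUnit_pow_pred_pow_eq_one hp (hx i), one_pow]

theorem pow_three_pow_add {M : Type*} [Monoid M] {x : M} (hx : x ^ 1024 = 1) {n : ℕ}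
    (hn : 3 ^ n ≡ 1 [MOD 1024]) (i : ℕ) : x ^ 3 ^ (i + n) = x ^ 3 ^ i := by
  refine pow_eq_pow_of_modEq_of_pow_eq_one hx ?_
  rw [pow_add]
  simpa using hn.mul_left (3 ^ i)

theorem conjChar_units_eq_one {R : Type*} [CommRing R] {p l N z η g V W c c' n w : ℕ}
    [Fact p.Prime] [Fact l.Prime] (hp : p < 2 ^ 16) (hn : n ≠ 0) (hn' : n < 2 ^ 32)
    (hN : N < 2 ^ 32) (h3 : 3 ^ n ≡ 1 [MOD 1024]) (hc : c ^ n ≡ 1 [MOD p]) (hl : l - 1 = N * p)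
    (hz : (z : ZMod (p ^ 2)) ^ 1024 = 1) (hη : (η : ZMod l) ^ 1024 = 1)
    (hg : (g : ZMod l) ^ p = 1) (hg1 : (g : ZMod l) ≠ 1)
    (hlog : logCheck l η g V N n = true) (hcirc : circulantCheck p V W c' n = true)
    (hprod : conjProd p z c (fun y => 1 + y + y * y) n % p ^ 2 = 1)
    (hw : w.Coprime p) (β : Fin (n - 1) → Rˣ)
    (hβ : ∀ x : Rˣ, ∃ (t : Rˣ) (k : Fin (n - 1) → ℤ), t ^ w = 1 ∧ x = t * ∏ i, β i ^ k i)
    {ζ : R} (ε : ℕ → Rˣ)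
    (hε : ∀ i, (ε i : R) = 1 + ζ ^ 3 ^ i + (ζ ^ 3 ^ i) ^ 2)
    (r : ℕ → R →+* ZMod (p ^ 2)) (hr : ∀ i, r i ζ = (z : ZMod (p ^ 2)) ^ 3 ^ i)
    (ρ : ℕ → R →+* ZMod l) (hρ : ∀ i, ρ i ζ = (η : ZMod l) ^ 3 ^ i) (u : Rˣ) :
    conjChar p c n r u = 1 := by
  have hp' := (Fact.out : p.Prime)
  have hg0 : (g : ZMod l) ≠ 0 := by
    rintro h
    rw [h, zero_pow hp'.ne_zero] at hg
    exact zero_ne_one hg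
  obtain ⟨d, hd⟩ := exists_monoidHom_multiplicative_zmod (R := ZMod l) (N := N) (p := p)
    (g := Units.mk0 (g : ZMod l) hg0)
    (fun x => by rw [← hl]; exact ZMod.units_pow_card_sub_one_eq_one l x)
    (orderOf_eq_prime (Units.ext (by simpa using hg))
      fun h => hg1 (by simpa using congrArg Units.val h))
  set L : Rˣ →* Multiplicative (Fin n → ZMod p) :=
    MonoidHom.mk' (fun x => Multiplicative.ofAdd fun j : Fin n =>
      (d (Units.map (ρ j : R →* ZMod l) x)).toAdd) (fun x y => by
        rw [← ofAdd_add]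
        congr 1
        ext j
        simp) with hL
  set Φ : Rˣ →* (ZMod (p ^ 2))ˣ := Units.map (conjChar p c n r) with hΦ
  have hεr : ∀ i j, r i (ε j) = 1 + (z : ZMod (p ^ 2)) ^ 3 ^ (i + j) + (z ^ 3 ^ (i + j)) ^ 2 := by
    intro i j
    simp only [hε, map_add, map_one, map_pow, hr, pow_add, pow_mul]
  have hερ : ∀ i j, ρ i (ε j) = 1 + (η : ZMod l) ^ 3 ^ (i + j) + (η ^ 3 ^ (i + j)) ^ 2 := by
    intro i j
    simp only [hε, map_add, map_one, map_pow, hρ, pow_add, pow_mul]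
  have hper : ∀ i, (η : ZMod l) ^ 3 ^ (i % n) = η ^ 3 ^ i := by
    intro i
    refine pow_eq_pow_of_modEq_of_pow_eq_one hη ?_
    conv_rhs => rw [← Nat.mod_add_div i n, pow_add, pow_mul]
    simpa using ((h3.pow (i / n)).mul_left (3 ^ (i % n))).symm
  suffices h : Φ u = 1 by simpa [hΦ] using congrArg Units.val h
  refine monoidHom_eq_one_of_le_finrank_span hw β hβ L ε ?_ Φ ?_ ?_ u
  · refine le_finrank_span_of_circulant _ (fun i => (digit V (i % n) : ZMod p))
      (fun i => (digit W i : ZMod p)) c' ?_ ?_ ?_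
    · intro i j
      change (d (Units.map (ρ j : R →* ZMod l) (ε i))).toAdd = _
      rw [hd _ (digit V ((i + j) % n)), toAdd_ofAdd]
      refine Units.ext ?_
      rw [Units.val_pow_eq_pow_val, Units.val_pow_eq_pow_val, Units.val_mk0, Units.coe_map,
        MonoidHom.coe_coe, hερ, ← pow_eq_pow_of_logCheck hlog hη hN hn'
          (Nat.mod_lt _ (Nat.pos_of_ne_zero hn)), hper, add_comm i]
    · intro i
      rw [Nat.add_mod_right]
    · intro i hi
      exact sum_of_circulantCheck hcirc hi
  · intro x
    refine Units.ext ?_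
    simpa [hΦ] using
      conjChar_pow_eq_one (c := c) (n := n) (r := r) hp' fun i => x.isUnit.map (r i)
  · intro j
    have hu : ∀ k, IsUnit (1 + (z : ZMod (p ^ 2)) ^ 3 ^ k + (z ^ 3 ^ k) ^ 2) := by
      intro k
      have := (ε k).isUnit.map (r 0)
      rwa [hεr, zero_add] at this
    have h1 := natCast_conjProd (g := fun y => 1 + y + y * y) (c := c) hp' hp hn' hz
      (fun i => 1 + (z : ZMod (p ^ 2)) ^ 3 ^ i + (z ^ 3 ^ i) ^ 2)
      (fun i y hy => by push_cast; rw [hy]; ring) hu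
    have h2 := congrArg (Nat.cast : ℕ → ZMod (p ^ 2)) hprod
    rw [ZMod.natCast_mod, h1, Nat.cast_one] at h2
    choose e he using hu
    have h4 := prod_range_shift_pow_eq_one (p := p) (c := c) (n := n) (fun k => e k ^ (p - 1))
      (fun k => Units.ext (by
        simpa using isUnit_pow_pred_pow_eq_one hp' (e k).isUnit))
      (fun k => congrArg (· ^ (p - 1)) (Units.ext (by
        rw [he, he, pow_three_pow_add hz h3])))
      hn hc (Units.ext (by
        rw [Units.val_one, ← h2]
        push_cast
        refine Finset.prod_congr rfl fun i _ => ?_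
        rw [he, pow_mul])) j
    refine Units.ext ?_
    rw [← h4, hΦ, Units.coe_map, conjChar_apply]
    push_cast
    refine Finset.prod_congr rfl fun i _ => ?_
    rw [hεr, he, pow_mul]

/-- The base `2 ^ 15` digits are discrete logarithms of conjugate units modulo `18875393`. -/
def unitLogs : ℕ :=
  4957377909674324323577022722432576466567396113703956585805324678347505433339919565616756316311889867722161517692703558417896860069043979618272077186132696864438893423621516699219187076902031203455538361700066043847920530824493881694833702366291501653866519050224808262618513705385169279776332706539903311884119209084946150464260565194362182435156151662669048209280793078021367021166882656599396575850354214118194283920593460130389062562836937062242948556140245052652201724945102635448443656125543491742884829602409862725093678594088997138895468048319500703369372290957174354619876802280600329779071757643355908259758476241778524028453035390136057406014458709629357397542070306106563472218800807832044426074117169434956824121302930362505718452428146400688796280388296893560375199428192077012209275256999129958591702998675592474141302759951682594477774538378093837714034879907090817074642962784016831644366164871087868569487390998499767774825271025302285872591668083892993815151129604900479016031444132014790096545575455557608185219641792468436547672820994200111197841238975421468380212843026260795011804410174590024528420322857453177788224722145351256590155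

/-- The base `2 ^ 15` digits invert the circulant matrix of the digits of `unitLogs`. -/
def unitLogsInv : ℕ :=
  1525555988032352247617101742143761842161590477964372479136396870386594510000326807267333903051629255330370170167160047563369124232339146969233663559176408531637089198853536899589121206102233316734653349372002751329414199165012681397792092033118475470879139950631410375233643446397242844540561249379613542293991052520227645108862009958471378952364609415705680985282268949079808892455314331143256422785469882815547039258663274055848995054828149872527570630665270655493962173977344616662553791966747466278646438311705048686409613947583846653969536828505839966192758011290992362257433995261929762840776009306609062408365387131485332268257034056349287752669600290818109598242133629304025928728495224527894554012656239197767839043814630483276099394189742024683790338625247346495878618429203789961172952583574704761493939828578454199250616659253711712157393327884674372119548560571771741946365517187054468291979863156408596520493178206275476457143683748524637683080523208845776351532403583683720712136333856743220032198585015611563695426189926256590794634612949909432372641940874279353962764109271824937975878718664022142221544896626813818506282182554431171538833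

theorem logCheck_unitLogs : logCheck 18875393 10841077 3680363 unitLogs 1024 256 = true := by
  decide +kernel

theorem circulantCheck_unitLogs :
    circulantCheck 18433 unitLogs unitLogsInv 18361 256 = true := by
  decide +kernel

theorem conjProd_unit_mod :
    conjProd 18433 327414619 12072 (fun y => 1 + y + y * y) 256 % 18433 ^ 2 = 1 := by
  decide +kernel

theorem conjProd_genFermat_mod :
    conjProd 18433 327414619 12072 (fun y => 20483116 ^ 2 + 1 + (18433 ^ 2 - 1) *
      (20483116 * (y + powMod (18433 ^ 2) y 1023))) 256 % 18433 ^ 2 = 255444515 := by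
  decide +kernel

theorem exists_ringHom_of_isPrimitiveRoot {n : ℕ} [NeZero n] {F : Type*} [Field F] [NumberField F]
    [IsCyclotomicExtension {n} ℚ F] {ζ : F} (hζ : IsPrimitiveRoot ζ n) {A : Type*} [CommRing A]
    (a : A) (ha : (cyclotomic n A).IsRoot a) : ∃ r : 𝓞 F →+* A, r hζ.toInteger = a := by
  have h : aeval a (minpoly ℤ hζ.integralPowerBasis.gen) = 0 := by
    rw [hζ.integralPowerBasis_gen, ← NumberField.RingOfIntegers.minpoly_coe]
    change aeval a (minpoly ℤ ζ) = 0
    rw [← cyclotomic_eq_minpoly hζ (NeZero.pos n), aeval_def, eval₂_eq_eval_map, map_cyclotomic]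
    exact ha.eq_zero
  obtain ⟨r, hr⟩ : ∃ r : 𝓞 F →+* A, r hζ.integralPowerBasis.gen = a :=
    ⟨(hζ.integralPowerBasis.lift a h).toRingHom, hζ.integralPowerBasis.lift_gen a h⟩
  rw [hζ.integralPowerBasis_gen] at hr
  exact ⟨r, hr⟩

theorem absNorm_span_natCast_sub_zeta {n : ℕ} [NeZero n] {F : Type*} [Field F] [NumberField F]
    [IsCyclotomicExtension {n} ℚ F] {ζ : F} (hζ : IsPrimitiveRoot ζ n) (a : ℕ) :
    (Ideal.absNorm (Ideal.span {(a : 𝓞 F) - hζ.toInteger}) : ℤ) =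
      |(cyclotomic n ℤ).eval (a : ℤ)| := by
  rw [Ideal.absNorm_span_singleton, Int.natCast_natAbs]
  congr 1
  have h1 : minpoly ℤ hζ.integralPowerBasis.gen = cyclotomic n ℤ := by
    rw [hζ.integralPowerBasis_gen, ← NumberField.RingOfIntegers.minpoly_coe]
    exact (cyclotomic_eq_minpoly hζ (NeZero.pos n)).symm
  rw [← h1, ← charpoly_leftMulMatrix, Matrix.eval_charpoly,
    Algebra.norm_eq_matrix_det hζ.integralPowerBasis.basis, map_sub, ← hζ.integralPowerBasis_gen]
  congr 2
  rw [← Int.cast_natCast, ← eq_intCast (algebraMap ℤ (𝓞 F)), AlgHom.commutes]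
  rfl

theorem exists_eq_mul_prod_zpow_fundSystem (K : Type*) [Field K] [NumberField K] (x : (𝓞 K)ˣ) :
    ∃ (t : (𝓞 K)ˣ) (k : Fin (NumberField.Units.rank K) → ℤ),
      t ^ NumberField.Units.torsionOrder K = 1 ∧
        x = t * ∏ i, NumberField.Units.fundSystem K i ^ k i := by
  obtain ⟨⟨t, k⟩, h, -⟩ := NumberField.Units.exist_unique_eq_mul_prod K x
  refine ⟨t, k, ?_, h⟩
  have := pow_card_eq_one' (x := t)
  exact_mod_cast congrArg Subtype.val this

theorem rank_cyclotomic {n : ℕ} [NeZero n] (hn : 2 < n) (F : Type*) [Field F] [NumberField F]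
    [IsCyclotomicExtension {n} ℚ F] : NumberField.Units.rank F = n.totient / 2 - 1 := by
  rw [NumberField.Units.rank, NumberField.InfinitePlace.card_eq_nrRealPlaces_add_nrComplexPlaces,
    IsCyclotomicExtension.Rat.nrRealPlaces_eq_zero (n := n) F hn, zero_add,
    IsCyclotomicExtension.Rat.nrComplexPlaces_eq_totient_div_two n]

theorem norm_sub_of_adjoin_eq_top {F L : Type*} [Field F] [Field L] [Algebra F L]
    [FiniteDimensional F L] {ζ : L} {θ : F} (hζ0 : ζ ≠ 0)
    (hθ : algebraMap F L θ = ζ + ζ⁻¹) (hζF : ζ ∉ (algebraMap F L).range)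
    (htop : Algebra.adjoin F {ζ} = ⊤) (a : F) :
    algebraMap F L (Algebra.norm F (algebraMap F L a - ζ)) =
      (algebraMap F L a - ζ) * (algebraMap F L a - ζ⁻¹) := by
  set x := algebraMap F L a - ζ with hx
  have hxint : IsIntegral F x := IsIntegral.of_finite F x
  have hxtop : Algebra.adjoin F {x} = ⊤ := by
    rw [eq_top_iff, ← htop]
    refine Algebra.adjoin_singleton_le ?_
    have : ζ = algebraMap F L a - x := by rw [hx, sub_sub_cancel]
    rw [this]
    exact sub_mem (Subalgebra.algebraMap_mem _ _) (Algebra.self_mem_adjoin_singleton F x)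
  set P : F[X] := X ^ 2 + (C (θ - 2 * a) * X + C (a ^ 2 - a * θ + 1)) with hP
  have hlt : (C (θ - 2 * a) * X + C (a ^ 2 - a * θ + 1)).degree < 2 :=
    degree_linear_le.trans_lt (by norm_num)
  have hPm : P.Monic := monic_X_pow_add hlt
  have hPd : P.natDegree = 2 := by
    rw [hP, natDegree_add_eq_left_of_degree_lt (hlt.trans_eq (degree_X_pow 2).symm),
      natDegree_X_pow]
  have hP0 : aeval x P = 0 := by
    rw [hP]
    simp only [map_add, map_mul, map_pow, aeval_X, aeval_C, map_sub, map_one, map_ofNat, hθ, hx]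
    field_simp
    ring
  have hmin : minpoly F x = P := by
    have h2 := (minpoly.two_le_natDegree_iff hxint).mpr fun h => hζF (by
      obtain ⟨y, hy⟩ := h
      exact ⟨a - y, by rw [map_sub, hy, hx, sub_sub_cancel]⟩)
    exact (eq_of_monic_of_dvd_of_natDegree_le (minpoly.monic hxint) hPm (minpoly.dvd F x hP0)
      (by omega)).symm
  have hn := Algebra.PowerBasis.norm_gen_eq_coeff_zero_minpoly
    (PowerBasis.ofAdjoinEqTop hxint hxtop)
  rw [PowerBasis.ofAdjoinEqTop_gen, PowerBasis.ofAdjoinEqTop_dim, hmin, hPd,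
    coeff_zero_eq_eval_zero, hP] at hn
  simp only [eval_add, eval_pow, eval_mul, eval_X, eval_C] at hn
  rw [hn]
  simp only [map_add, map_sub, map_mul, map_pow, map_one, map_zero, map_neg, hθ, hx]
  field_simp
  ring

theorem cyclotomic_1024 (A : Type*) [CommRing A] : cyclotomic 1024 A = X ^ 512 + 1 := by
  have h := cyclotomic_prime_pow_eq_geom_sum (R := A) (n := 9) Nat.prime_two
  norm_num [Finset.sum_range_succ] at h
  rw [h, add_comm]

theorem isUnit_natCast_sub_of_pow_eq_neg_one {A : Type*} [CommRing A] {a n : ℕ} {t : A}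
    (ht : t ^ n = -1) (h : IsUnit ((a : A) ^ n + 1)) : IsUnit ((a : A) - t) := by
  refine isUnit_of_dvd_unit ?_ h
  have := sub_dvd_pow_sub_pow (a : A) t n
  rwa [ht, sub_neg_eq_add] at this

theorem dvd_card_classGroup_of_checks {F F' K M : Type*} [Field F] [NumberField F] [Field F']
    [NumberField F'] [Field K] [NumberField K] [Field M] [NumberField M] [Algebra F F']
    [Algebra F K] [Algebra F M] [Algebra F' M] [Algebra K M] [IsScalarTower F F' M]
    [IsScalarTower F K M] [IsGalois F F'] {p l N z η g V W c c' a q : ℕ} [Fact p.Prime]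
    [Fact l.Prime] [IsCyclotomicExtension {1024} ℚ F'] [IsCyclotomicExtension {1024 * p ^ 2} ℚ M]
    {ζ : F'} (hζ : IsPrimitiveRoot ζ 1024) {θ : F} (hθ : algebraMap F F' θ = ζ + ζ⁻¹)
    (hζF : ζ ∉ (algebraMap F F').range) (htop : Algebra.adjoin F {ζ} = ⊤)
    (hKM : ¬ p ∣ Module.finrank K M) (hp : p < 2 ^ 16) (hp2 : p ≠ 2) (hN : N < 2 ^ 32)
    (hc : c ^ 256 ≡ 1 [MOD p]) (hl : l - 1 = N * p)
    (hz : (z : ZMod (p ^ 2)) ^ 512 = -1) (hη : (η : ZMod l) ^ 512 = -1)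
    (hg : (g : ZMod l) ^ p = 1) (hg1 : (g : ZMod l) ≠ 1)
    (hlog : logCheck l η g V N 256 = true) (hcirc : circulantCheck p V W c' 256 = true)
    (hprod : conjProd p z c (fun y => 1 + y + y * y) 256 % p ^ 2 = 1)
    (hq : q = a ^ 512 + 1) (hqp : q.Prime) (hq1 : (q : ZMod (1024 * p ^ 2)) ^ (p - 1) = 1)
    (hγ : conjProd p z c (fun y => a ^ 2 + 1 + (p ^ 2 - 1) * (a * (y + powMod (p ^ 2) y 1023)))
      256 % p ^ 2 ≠ 1) :
    p ∣ Nat.card (ClassGroup (𝓞 K)) := by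
  have hp' := (Fact.out : p.Prime)
  have hp2' : Nat.Coprime 2 p := (Nat.coprime_primes Nat.prime_two hp').mpr hp2.symm
  have hpp : 1 < p ^ 2 := Nat.one_lt_pow two_ne_zero hp'.one_lt
  have : NeZero (p ^ 2) := ⟨by omega⟩
  have hz' : (z : ZMod (p ^ 2)) ^ 1024 = 1 := by
    rw [show 1024 = 512 * 2 by norm_num, pow_mul, hz, neg_one_sq]
  have hη' : (η : ZMod l) ^ 1024 = 1 := by
    rw [show 1024 = 512 * 2 by norm_num, pow_mul, hη, neg_one_sq]
  have hroot : ∀ {A : Type} [CommRing A] {x : A}, x ^ 512 = -1 → ∀ i : ℕ,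
      (cyclotomic 1024 A).IsRoot (x ^ 3 ^ i) := by
    intro A _ x hx i
    have : Odd (3 ^ i) := Odd.pow (by decide)
    rw [IsRoot, cyclotomic_1024, eval_add, eval_pow, eval_X, eval_one, ← pow_mul, mul_comm,
      pow_mul, hx, this.neg_one_pow, neg_add_cancel]
  choose r hr using fun i => exists_ringHom_of_isPrimitiveRoot hζ _ (hroot hz i)
  choose ρ hρ using fun i => exists_ringHom_of_isPrimitiveRoot hζ _ (hroot hη i)
  set ω := hζ.toInteger with hω
  have hωprim : IsPrimitiveRoot ω 1024 := hζ.toInteger_isPrimitiveRoot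
  have hωζ : (ω : F') = ζ := rfl
  have hω512 : ω ^ 512 = -1 := by
    have h1 : (ω ^ 512) ^ 2 = 1 := by rw [← pow_mul]; exact hωprim.pow_eq_one
    rcases sq_eq_one_iff.mp h1 with h | h
    · exact absurd h (hωprim.pow_ne_one_of_pos_of_lt (by norm_num) (by norm_num))
    · exact h
  have hε : ∀ i, ∃ e : (𝓞 F')ˣ, (e : 𝓞 F') = 1 + ω ^ 3 ^ i + (ω ^ 3 ^ i) ^ 2 := by
    intro i
    have h1 := (hωprim.pow_of_coprime (3 ^ i)
      (Nat.Coprime.pow_left i (by norm_num))).geom_sum_isUnit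
      (j := 3) (by norm_num) (by norm_num)
    rw [Finset.sum_range_succ, Finset.sum_range_succ, Finset.sum_range_one, pow_zero, pow_one] at h1
    exact ⟨h1.unit, rfl⟩
  choose ε hε using hε
  have htors : (NumberField.Units.torsionOrder F').Coprime p := by
    rw [IsCyclotomicExtension.Rat.torsionOrder_eq (n := 1024), if_pos (by decide)]
    exact Nat.Coprime.pow_left 10 hp2'
  have hrank : NumberField.Units.rank F' = 256 - 1 := by
    rw [rank_cyclotomic (n := 1024) (by norm_num), show 1024 = 2 ^ (9 + 1) by norm_num,
      Nat.totient_prime_pow_succ Nat.prime_two]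
    norm_num
  have hfund := exists_eq_mul_prod_zpow_fundSystem F'
  generalize NumberField.Units.fundSystem F' = β at hfund
  revert β
  rw [hrank]
  intro β hfund
  have hunit := conjChar_units_eq_one (n := 256) hp (by norm_num) (by norm_num) hN (by decide) hc hl
    hz' hη' hg hg1 hlog hcirc hprod htors β hfund ε hε r hr ρ hρ
  set π : 𝓞 F' := (a : 𝓞 F') - ω with hπ
  have hπN : Ideal.absNorm (Ideal.span {π}) = q := by
    have h1 := absNorm_span_natCast_sub_zeta hζ a
    rw [cyclotomic_1024] at h1
    simp only [eval_add, eval_pow, eval_X, eval_one] at h1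
    rw [abs_of_nonneg (by positivity)] at h1
    rw [hq]
    exact_mod_cast h1
  set γ : 𝓞 F' := algebraMap (𝓞 F) (𝓞 F') (Algebra.intNorm (𝓞 F) (𝓞 F') π) with hγdef
  have hγω : γ = ((a : 𝓞 F') - ω) * ((a : 𝓞 F') - ω ^ 1023) := by
    have hζ0 : ζ ≠ 0 := hζ.ne_zero (by norm_num)
    refine RingOfIntegers.ext ?_
    have h1 : ((π : 𝓞 F') : F') = algebraMap F F' (a : F) - ζ := by
      simp [hπ, hωζ]
    have h2 := norm_sub_of_adjoin_eq_top hζ0 hθ hζF htop (a : F)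
    have h3 : ζ⁻¹ = ζ ^ 1023 := by
      rw [inv_eq_iff_eq_inv, eq_comm, inv_eq_of_mul_eq_one_left]
      rw [← pow_succ']
      exact hζ.pow_eq_one
    rw [← h1, ← Algebra.algebraMap_intNorm (A := 𝓞 F) (B := 𝓞 F') (K := F) (L := F'), h1, h3] at h2
    rw [hγdef]
    refine Eq.trans ?_ (h2.trans ?_)
    · rfl
    · simp [hωζ]
  have hqu : IsUnit (q : ZMod (1024 * p ^ 2)) :=
    IsUnit.of_pow_eq_one hq1 (Nat.sub_ne_zero_of_lt hp'.one_lt)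
  have hqc : q.Coprime (1024 * p ^ 2) := (ZMod.isUnit_iff_coprime _ _).mp hqu
  have hqu' : IsUnit ((a : ZMod (p ^ 2)) ^ 512 + 1) := by
    have := (ZMod.isUnit_iff_coprime q (p ^ 2)).mpr hqc.coprime_mul_left_right
    rw [hq] at this
    exact_mod_cast this
  have hγu : ∀ s : 𝓞 F' →+* ZMod (p ^ 2), IsUnit (s γ) := by
    intro s
    have h1 : s ω ^ 512 = -1 := by rw [← map_pow, hω512, map_neg, map_one]
    rw [hγω, map_mul, map_sub, map_sub, map_natCast, map_pow]
    refine (isUnit_natCast_sub_of_pow_eq_neg_one h1 hqu').mul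
      (isUnit_natCast_sub_of_pow_eq_neg_one ?_ hqu')
    rw [pow_right_comm, h1, Odd.neg_one_pow (by decide)]
  have hcop : Nat.Coprime 1024 (p ^ 2) := Nat.Coprime.pow 10 2 hp2'
  obtain ⟨f, u, hf, hfu⟩ := exists_unit_forall_ringHom_pow_eq_one (F := F) (K := K) (M := M)
    (n := 1024) (m := p ^ 2) hcop π (hπN.symm ▸ hqp)
    (by
      rw [hπN]
      intro h
      exact hqp.one_lt.ne' (Nat.Coprime.eq_one_of_dvd hqc h)) hγu
  rw [hπN] at hf
  have hfp : f.Coprime p := by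
    refine (Nat.Coprime.coprime_dvd_left (hf.trans (orderOf_dvd_of_pow_eq_one hq1)) ?_)
    exact (Nat.coprime_self_sub_left hp'.one_lt.le).mpr (Nat.coprime_one_left p)
  by_contra hcon
  set h := Nat.card (ClassGroup (𝓞 K)) with hh
  set d := Module.finrank K M with hd
  have h1 : conjChar p c 256 r (u * γ ^ (f * h)) ^ (2 * d) = 1 := by
    rw [conjChar_apply, ← Finset.prod_pow]
    refine Finset.prod_eq_one fun i _ => ?_
    rw [pow_right_comm, hfu (r i), one_pow]
  rw [map_mul, hunit, one_mul, map_pow, ← pow_mul] at h1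
  have h2 := conjChar_pow_eq_one (c := c) (n := 256) (r := r) hp' fun i => hγu (r i)
  have h3 : (f * h * (2 * d)).Coprime p :=
    (hfp.mul_left ((Nat.Prime.coprime_iff_not_dvd hp').mpr hcon).symm).mul_left
      (hp2'.mul_left ((Nat.Prime.coprime_iff_not_dvd hp').mpr hKM).symm)
  have h4 : conjChar p c 256 r γ = 1 := orderOf_eq_one_iff.mp
    (Nat.eq_one_of_dvd_coprimes h3 (orderOf_dvd_of_pow_eq_one h1) (orderOf_dvd_of_pow_eq_one h2))
  refine hγ ?_
  have h5 := natCast_conjProd (n := 256) (c := c)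
    (g := fun y => a ^ 2 + 1 + (p ^ 2 - 1) * (a * (y + powMod (p ^ 2) y 1023))) hp' hp
    (by norm_num) hz' (fun i => r i γ) (fun i y hy => by
      have h6 : ((p ^ 2 - 1 : ℕ) : ZMod (p ^ 2)) = -1 := by
        rw [Nat.cast_sub hpp.le, CharP.cast_eq_zero, Nat.cast_one, zero_sub]
      have h7 : (y : ZMod (p ^ 2)) ^ 1024 = 1 := by
        rw [hy, pow_right_comm, hz', one_pow]
      rw [hγω, map_mul, map_sub, map_sub, map_natCast, map_pow, hr, ← hy, Nat.cast_add,
        Nat.cast_mul, h6, Nat.cast_mul, Nat.cast_add y, natCast_powMod _ _ _ (by norm_num)]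
      push_cast
      linear_combination -h7) fun i => hγu (r i)
  rw [← conjChar_apply, h4] at h5
  exact ((ZMod.natCast_eq_natCast_iff' _ 1 _).mp (h5.trans Nat.cast_one.symm)).trans
    (Nat.mod_eq_of_lt hpp)

theorem natCast_pow_eq_neg_one_of_powMod {m b e : ℕ} (he : e < 2 ^ 32)
    (h : powMod m b e + 1 = m) : (b : ZMod m) ^ e = -1 := by
  rw [← natCast_powMod _ _ _ he, eq_neg_iff_add_eq_zero, ← Nat.cast_add_one, h,
    CharP.cast_eq_zero]

theorem natCast_pow_eq_one_of_powMod {m b e : ℕ} (he : e < 2 ^ 32)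
    (h : powMod m b e = 1) : (b : ZMod m) ^ e = 1 := by
  rw [← natCast_powMod _ _ _ he, h, Nat.cast_one]

theorem dvd_card_classGroup_18433 {F F' K M : Type*} [Field F] [NumberField F] [Field F']
    [NumberField F'] [Field K] [NumberField K] [Field M] [NumberField M] [Algebra F F']
    [Algebra F K] [Algebra F M] [Algebra F' M] [Algebra K M] [IsScalarTower F F' M]
    [IsScalarTower F K M] [IsGalois F F'] [IsCyclotomicExtension {1024} ℚ F']
    [IsCyclotomicExtension {1024 * 18433 ^ 2} ℚ M]
    {ζ : F'} (hζ : IsPrimitiveRoot ζ 1024) {θ : F} (hθ : algebraMap F F' θ = ζ + ζ⁻¹)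
    (hζF : ζ ∉ (algebraMap F F').range) (htop : Algebra.adjoin F {ζ} = ⊤)
    (hKM : ¬ 18433 ∣ Module.finrank K M) :
    18433 ∣ Nat.card (ClassGroup (𝓞 K)) := by
  have : Fact (Nat.Prime 18433) := ⟨by norm_num⟩
  have : Fact (Nat.Prime 18875393) := ⟨by norm_num⟩
  obtain ⟨q, hq⟩ : ∃ q, q = 20483116 ^ 512 + 1 := ⟨_, rfl⟩
  refine dvd_card_classGroup_of_checks (l := 18875393) (N := 1024) (z := 327414619)
    (η := 10841077) (g := 3680363) (c := 12072) hζ hθ hζF htop hKM (by norm_num) (by norm_num)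
    (by norm_num) ?_ (by norm_num) ?_ ?_ ?_ ?_ logCheck_unitLogs circulantCheck_unitLogs
    conjProd_unit_mod hq (prime_genFermat hq) (genFermat_pow_eq_one hq) ?_
  · exact (powMod_modEq 18433 12072 256 (by norm_num)).symm.trans (by decide +kernel)
  · exact natCast_pow_eq_neg_one_of_powMod (by norm_num) (by decide +kernel)
  · exact natCast_pow_eq_neg_one_of_powMod (by norm_num) (by decide +kernel)
  · exact natCast_pow_eq_one_of_powMod (by norm_num) (by decide +kernel)
  · intro h
    have := (ZMod.natCast_eq_natCast_iff' 3680363 1 18875393).mp (h.trans Nat.cast_one.symm)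
    norm_num at this
  · rw [conjProd_genFermat_mod]
    norm_num

theorem numberField_of_le {K M : IntermediateField ℚ ℂ} (h : K ≤ M) [NumberField M] :
    NumberField K where
  to_charZero := inferInstance
  to_finiteDimensional := Module.Finite.of_injective (IntermediateField.inclusion h).toLinearMap
    (IntermediateField.inclusion h).injective

theorem adjoin_eq_top_of_tower {R A B : Type*} [CommSemiring R] [CommSemiring A] [Semiring B]
    [Algebra R A] [Algebra A B] [Algebra R B] [IsScalarTower R A B] {s : Set B}
    (h : Algebra.adjoin R s = ⊤) : Algebra.adjoin A s = ⊤ := by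
  have h1 : Algebra.adjoin R s ≤ (Algebra.adjoin A s).restrictScalars R :=
    Algebra.adjoin_le Algebra.subset_adjoin
  rw [h] at h1
  exact eq_top_iff.mpr fun x _ => h1 Algebra.mem_top

theorem finrank_mul_finrank_dvd (E K M : Type*) {k : Type*} [Field k] [Field E] [Field K] [Field M]
    [Algebra k E] [Algebra k K] [Algebra k M] [Algebra E K] [Algebra K M] [IsScalarTower k E K]
    [IsScalarTower k K M] :
    Module.finrank k E * Module.finrank K M ∣ Module.finrank k M :=
  ⟨Module.finrank E K, by
    rw [← Module.finrank_mul_finrank k K M, ← Module.finrank_mul_finrank k E K, mul_right_comm]⟩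

theorem finrank_cyclotomic_1024_mul {M : Type*} [Field M] [Algebra ℚ M]
    [IsCyclotomicExtension {1024 * 18433 ^ 2} ℚ M] :
    Module.finrank ℚ M = 512 * (18433 * 18432) := by
  have : NeZero (1024 * 18433 ^ 2) := ⟨by norm_num⟩
  have h1 : Nat.totient (2 ^ (9 + 1)) = 512 := by
    rw [Nat.totient_prime_pow_succ Nat.prime_two]
    norm_num
  have h2 : Nat.totient (18433 ^ (1 + 1)) = 18433 * 18432 := by
    rw [Nat.totient_prime_pow_succ (by norm_num)]
    norm_num
  rw [IsCyclotomicExtension.finrank (n := 1024 * 18433 ^ 2) M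
    (cyclotomic.irreducible_rat (by norm_num)), Nat.totient_mul (by norm_num)]
  exact congrArg₂ _ h1 h2

/-- `18433` divides the class number of the compositum `ℚ(2⁸)·ℚ(18433)`, where `ℚ(2⁸)` is the
maximal real subfield of `ℚ(ζ_{2¹⁰})` (the `8`-th layer of the cyclotomic `ℤ₂`-extension
of `ℚ`) and `ℚ(18433)` is the unique degree-`18433` subfield of `ℚ(ζ_{18433²})`, the
compositum being taken inside `ℂ`. -/
theorem p18433_dvd_classNumber
    (K₁ K₂ : IntermediateField ℚ ℂ)
    (ζ : ℂ) (hζ : IsPrimitiveRoot ζ (2 ^ 10))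
    (hK₁sub : K₁ ≤ IntermediateField.adjoin ℚ {ζ})
    (hK₁real : ∀ x ∈ K₁, (starRingEnd ℂ) x = x)
    (hK₁max : ∀ B : IntermediateField ℚ ℂ, B ≤ IntermediateField.adjoin ℚ {ζ} →
      (∀ x ∈ B, (starRingEnd ℂ) x = x) → B ≤ K₁)
    (ξ : ℂ) (hξ : IsPrimitiveRoot ξ (18433 ^ 2))
    (hK₂sub : K₂ ≤ IntermediateField.adjoin ℚ {ξ})
    (hK₂deg : Module.finrank ℚ K₂ = 18433) :
    18433 ∣ Nat.card (ClassGroup (𝓞 ↥(K₁ ⊔ K₂))) := by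
  replace hζ : IsPrimitiveRoot ζ 1024 := hζ
  set L := IntermediateField.adjoin ℚ {ζ} with hL
  set M := IntermediateField.adjoin ℚ {ζ * ξ} with hM
  have hζ0 : ζ ≠ 0 := hζ.ne_zero (by norm_num)
  have hζξ : IsPrimitiveRoot (ζ * ξ) (1024 * 18433 ^ 2) :=
    hζ.mul_of_coprime (by norm_num) hξ
  have : NeZero (1024 * 18433 ^ 2) := ⟨by norm_num⟩
  have hcycL : IsCyclotomicExtension {1024} ℚ L :=
    (IntermediateField.isCyclotomicExtension_singleton_iff_eq_adjoin _ ℚ ℂ L hζ).mpr rfl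
  have hcycM : IsCyclotomicExtension {1024 * 18433 ^ 2} ℚ M :=
    (IntermediateField.isCyclotomicExtension_singleton_iff_eq_adjoin _ ℚ ℂ M hζξ).mpr rfl
  have : NumberField L := IsCyclotomicExtension.numberField {1024} ℚ L
  have : NumberField M := IsCyclotomicExtension.numberField {1024 * 18433 ^ 2} ℚ M
  have hmem : ∀ {x : ℂ}, x ^ (1024 * 18433 ^ 2) = 1 → x ∈ M := by
    intro x hx
    obtain ⟨i, -, rfl⟩ := hζξ.eq_pow_of_pow_eq_one hx
    exact pow_mem (IntermediateField.mem_adjoin_simple_self ℚ _) i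
  have hLM : L ≤ M := IntermediateField.adjoin_simple_le_iff.mpr
    (hmem (by rw [pow_mul, hζ.pow_eq_one, one_pow]))
  have hK₂M : K₂ ≤ M := hK₂sub.trans (IntermediateField.adjoin_simple_le_iff.mpr
    (hmem (by rw [mul_comm 1024, pow_mul, hξ.pow_eq_one, one_pow])))
  have hKM : K₁ ⊔ K₂ ≤ M := sup_le (hK₁sub.trans hLM) hK₂M
  have hK₁K : K₁ ≤ K₁ ⊔ K₂ := le_sup_left
  let : Algebra K₁ L := (IntermediateField.inclusion hK₁sub).toAlgebra
  let : Algebra K₁ ↥(K₁ ⊔ K₂) := (IntermediateField.inclusion hK₁K).toAlgebra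
  let : Algebra K₁ M := (IntermediateField.inclusion (hK₁sub.trans hLM)).toAlgebra
  let : Algebra L M := (IntermediateField.inclusion hLM).toAlgebra
  let : Algebra ↥(K₁ ⊔ K₂) M := (IntermediateField.inclusion hKM).toAlgebra
  let : Algebra K₂ ↥(K₁ ⊔ K₂) :=
    (IntermediateField.inclusion (le_sup_right : K₂ ≤ K₁ ⊔ K₂)).toAlgebra
  have : IsScalarTower K₁ L M := IsScalarTower.of_algebraMap_eq fun _ => rfl
  have : IsScalarTower K₁ ↥(K₁ ⊔ K₂) M := IsScalarTower.of_algebraMap_eq fun _ => rfl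
  have : IsScalarTower ℚ K₁ L := IsScalarTower.of_algebraMap_eq fun _ => rfl
  have : IsScalarTower ℚ ↥(K₁ ⊔ K₂) M := IsScalarTower.of_algebraMap_eq fun _ => rfl
  have : IsScalarTower ℚ K₂ ↥(K₁ ⊔ K₂) := IsScalarTower.of_algebraMap_eq fun _ => rfl
  have : NumberField K₁ := numberField_of_le hK₁sub
  have : NumberField ↥(K₁ ⊔ K₂) := numberField_of_le hKM
  have : IsGalois ℚ L := IsCyclotomicExtension.isGalois {1024} ℚ L
  have : IsGalois K₁ L := IsGalois.tower_top_of_isGalois ℚ K₁ L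
  have hconj : (starRingEnd ℂ) ζ = ζ⁻¹ := by
    rw [Complex.inv_eq_conj (hζ.norm'_eq_one (by norm_num))]
  have hζL : ζ ∈ L := IntermediateField.mem_adjoin_simple_self ℚ ζ
  have hθK₁ : ζ + ζ⁻¹ ∈ K₁ := by
    refine IntermediateField.adjoin_simple_le_iff.mp (hK₁max (IntermediateField.adjoin ℚ {ζ + ζ⁻¹})
      (IntermediateField.adjoin_simple_le_iff.mpr (add_mem hζL (inv_mem hζL))) fun x hx => ?_)
    induction hx using IntermediateField.adjoin_induction with
    | mem x hx =>
      rw [Set.mem_singleton_iff.mp hx, map_add, map_inv₀, hconj, inv_inv, add_comm]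
    | algebraMap x => simp
    | add x y _ _ hx hy => rw [map_add, hx, hy]
    | inv x _ hx => rw [map_inv₀, hx]
    | mul x y _ _ hx hy => rw [map_mul, hx, hy]
  have hζL' : IsPrimitiveRoot (⟨ζ, hζL⟩ : L) 1024 := IsPrimitiveRoot.coe_submonoidClass_iff.mp hζ
  refine dvd_card_classGroup_18433 (F := K₁) (F' := L) (M := M) hζL' (θ := ⟨ζ + ζ⁻¹, hθK₁⟩) rfl
    ?_ ?_ ?_
  · rintro ⟨x, hx⟩
    have h1 : ζ = x := (congrArg Subtype.val hx).symm
    have h2 : ζ⁻¹ = ζ := by rw [← hconj, h1, hK₁real _ x.2]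
    have h3 : ζ ^ 2 = 1 := by
      nth_rw 1 [pow_two, ← h2, inv_mul_cancel₀ hζ0]
    exact hζ.pow_ne_one_of_pos_of_lt (by norm_num) (by norm_num) h3
  · exact adjoin_eq_top_of_tower (IsCyclotomicExtension.adjoin_primitive_root_eq_top (A := ℚ) hζL')
  · intro hdvd
    have h := mul_dvd_mul (dvd_of_eq hK₂deg.symm) hdvd
    have h1 := h.trans (finrank_mul_finrank_dvd K₂ ↥(K₁ ⊔ K₂) M)
    rw [finrank_cyclotomic_1024_mul] at h1
    norm_num at h1
end
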